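/- arXiv:1109.5751 — 2 statements merged into one kernel-verified Lean document; each statement's English description precedes it below -/
import Mathlib

section
/- Let (X_t) be a real continuous martingale and (Y_t) a real continuous martingale with Y_0 = 0 that is differentially subordinate to X (i.e., [X,X]_t - [Y,Y]_t is nonnegative and nondecreasing in t). Then for 1 < p < ∞, sup_t ||Y_t||_p ≤ (p*-1) sup_t ||X_t||_p, where p* = max{p, p/(p-1)}. -/
open MeasureTheory Filter Set
open scoped NNReal ENNReal Topology

theorem exists_countable_stoppingTime_approx {Ω : Type*} {m : MeasurableSpace Ω}
    {ℱ : Filtration ℝ≥0 m} {T : ℝ≥0} {ρ : Ω → ℝ≥0}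
    (hρ : IsStoppingTime ℱ fun ω => (ρ ω : WithTop ℝ≥0)) (hρT : ∀ ω, ρ ω ≤ T) :
    ∃ σ : ℕ → Ω → ℝ≥0, (∀ n, IsStoppingTime ℱ fun ω => (σ n ω : WithTop ℝ≥0)) ∧
      (∀ n ω, σ n ω ≤ T) ∧ (∀ n, (range (σ n)).Countable) ∧
      ∀ ω, Tendsto (fun n => σ n ω) atTop (𝓝 (ρ ω)) := by
  refine ⟨fun n ω => min T (⌈ρ ω * (n + 1)⌉₊ / (n + 1)), fun n t => ?_, fun n ω => min_le_left _ _,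
    fun n => ?_, fun ω => ?_⟩
  · have hn : (0 : ℝ≥0) < n + 1 := by positivity
    by_cases hT : T ≤ t
    · have : {ω | ((min T (⌈ρ ω * (n + 1)⌉₊ / (n + 1)) : ℝ≥0) : WithTop ℝ≥0) ≤ t} = univ := by
        ext ω
        simp only [mem_ofPred_eq, WithTop.coe_le_coe, mem_univ, iff_true]
        exact (min_le_left _ _).trans hT
      rw [this]
      exact @MeasurableSet.univ _ (ℱ t)
    · have : {ω | ((min T (⌈ρ ω * (n + 1)⌉₊ / (n + 1)) : ℝ≥0) : WithTop ℝ≥0) ≤ t} =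
          {ω | (ρ ω : WithTop ℝ≥0) ≤ ((⌊t * (n + 1)⌋₊ / (n + 1) : ℝ≥0) : WithTop ℝ≥0)} := by
        ext ω
        simp only [mem_ofPred_eq, WithTop.coe_le_coe, min_le_iff, hT, false_or]
        rw [div_le_iff₀ hn, le_div_iff₀ hn, ← Nat.le_floor_iff (by positivity), Nat.ceil_le]
      rw [this]
      refine ℱ.mono ?_ _ (hρ _)
      rw [div_le_iff₀ hn]
      exact Nat.floor_le (by positivity)
  · refine (countable_range fun k : ℕ => min T ((k : ℝ≥0) / (n + 1))).mono ?_
    rintro _ ⟨ω, rfl⟩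
    exact ⟨⌈ρ ω * (n + 1)⌉₊, rfl⟩
  · have h : Tendsto (fun n : ℕ => (⌈ρ ω * ((n : ℝ≥0) + 1)⌉₊ : ℝ≥0) / (n + 1)) atTop
        (𝓝 (ρ ω)) := by
      rw [← NNReal.tendsto_coe]
      have h1 := (tendsto_nat_ceil_mul_div_atTop (R := ℝ) (ρ ω).coe_nonneg).comp
        (tendsto_natCast_atTop_atTop.comp (tendsto_add_atTop_nat 1))
      refine h1.congr fun n => ?_
      have : ⌈(ρ ω : ℝ) * (n + 1)⌉₊ = ⌈ρ ω * ((n : ℝ≥0) + 1)⌉₊ := by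
        refine eq_of_forall_ge_iff fun k => ?_
        rw [Nat.ceil_le, Nat.ceil_le]
        exact_mod_cast Iff.rfl
      simp [this]
    have := (tendsto_const_nhds (x := T)).min h
    rwa [min_eq_right (hρT ω)] at this

theorem optional_stopping {Ω : Type*} {m : MeasurableSpace Ω} {P : Measure Ω}
    [IsProbabilityMeasure P] {ℱ : Filtration ℝ≥0 m} {M : ℝ≥0 → Ω → ℝ} (hM : Martingale M ℱ P)
    (hMc : ∀ ω, Continuous fun t => M t ω) {T : ℝ≥0} {ρ : Ω → ℝ≥0}
    (hρ : IsStoppingTime ℱ fun ω => (ρ ω : WithTop ℝ≥0)) (hρT : ∀ ω, ρ ω ≤ T) :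
    Integrable (fun ω => M (ρ ω) ω) P ∧ ∫ ω, M (ρ ω) ω ∂P = ∫ ω, M T ω ∂P ∧
      ∀ q : ℝ≥0∞, 1 ≤ q → eLpNorm (fun ω => M (ρ ω) ω) q P ≤ eLpNorm (M T) q P := by
  obtain ⟨σ, hσ, hσT, hσc, hσlim⟩ := exists_countable_stoppingTime_approx hρ hρT
  have hce : ∀ n, (fun ω => M (σ n ω) ω) =ᵐ[P] P[M T | (hσ n).measurableSpace] := fun n => by
    have := hM.stoppedValue_ae_eq_condExp_of_le_const_of_countable_range (hσ n) (n := T)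
      (fun ω => by exact_mod_cast hσT n ω) ?_
    · exact this
    · have := (hσc n).image ((↑) : ℝ≥0 → WithTop ℝ≥0)
      rwa [← range_comp] at this
  have hlim : ∀ ω, Tendsto (fun n => M (σ n ω) ω) atTop (𝓝 (M (ρ ω) ω)) := fun ω =>
    ((hMc ω).tendsto _).comp (hσlim ω)
  have hint : ∀ n, Integrable (fun ω => M (σ n ω) ω) P := fun n =>
    integrable_condExp.congr (hce n).symm
  have hui : UniformIntegrable (fun n ω => M (σ n ω) ω) 1 P :=
    ((hM.integrable T).uniformIntegrable_condExp
      fun n => (hσ n).measurableSpace_le).ae_eq fun n => (hce n).symm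
  have hLp : ∀ q : ℝ≥0∞, 1 ≤ q → eLpNorm (fun ω => M (ρ ω) ω) q P ≤ eLpNorm (M T) q P := by
    intro q hq
    refine (Lp.eLpNorm_lim_le_liminf_eLpNorm (fun n => (hint n).1) _ (ae_of_all _ hlim)).trans ?_
    refine (liminf_le_liminf (Eventually.of_forall fun n => ?_)).trans
      (liminf_const (f := atTop (α := ℕ)) (eLpNorm (M T) q P)).le
    rw [eLpNorm_congr_ae (hce n)]
    exact eLpNorm_condExp_le_eLpNorm _ hq
  have hm1 : MemLp (fun ω => M (ρ ω) ω) 1 P :=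
    ⟨aestronglyMeasurable_of_tendsto_ae atTop (fun n => (hint n).1) (ae_of_all _ hlim),
      (hLp 1 le_rfl).trans_lt (memLp_one_iff_integrable.2 (hM.integrable T)).2⟩
  refine ⟨memLp_one_iff_integrable.1 hm1, ?_, hLp⟩
  have hL1 := tendsto_Lp_finite_of_tendsto_ae le_rfl ENNReal.one_ne_top (fun n => (hint n).1) hm1
    hui.2.1 (ae_of_all _ hlim)
  have h1 : Tendsto (fun n => ∫ ω, M (σ n ω) ω ∂P) atTop (𝓝 (∫ ω, M (ρ ω) ω ∂P)) :=
    tendsto_integral_of_L1' _ hm1.1 (Eventually.of_forall hint) hL1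
  refine tendsto_nhds_unique h1 (tendsto_const_nhds.congr fun n => ?_)
  rw [integral_congr_ae (hce n), integral_condExp (hσ n).measurableSpace_le]

/-- A stopped continuous martingale, restricted to an event known at time `0`, is a martingale. -/
theorem martingale_indicator_stopped {Ω : Type*} {m : MeasurableSpace Ω} {P : Measure Ω}
    [IsProbabilityMeasure P] {ℱ : Filtration ℝ≥0 m} {M : ℝ≥0 → Ω → ℝ} (hM : Martingale M ℱ P)
    (hMc : ∀ ω, Continuous fun t => M t ω) {ρ : Ω → ℝ≥0}
    (hρ : IsStoppingTime ℱ fun ω => (ρ ω : WithTop ℝ≥0))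
    {A : Set Ω} (hA : MeasurableSet[ℱ 0] A) :
    Martingale (fun t => A.indicator fun ω => M (min (ρ ω) t) ω) ℱ P := by
  have hst : ∀ t : ℝ≥0, IsStoppingTime ℱ fun ω => ((min (ρ ω) t : ℝ≥0) : WithTop ℝ≥0) :=
    fun t => by simpa using hρ.min_const t
  have hint : ∀ t, Integrable (fun ω => M (min (ρ ω) t) ω) P := fun t =>
    (optional_stopping hM hMc (hst t) fun ω => min_le_right _ _).1
  have hAm : ∀ t, MeasurableSet[ℱ t] A := fun t => ℱ.mono (zero_le (a := t)) _ hA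
  have hmeas : ∀ t, StronglyMeasurable[ℱ t] fun ω => M (min (ρ ω) t) ω := fun t => by
    have := stronglyMeasurable_stoppedValue_of_le (hM.1.isStronglyProgressive_of_continuous hMc)
      (hst t) (n := t) (fun ω => by exact_mod_cast min_le_right _ _)
    exact this
  refine ⟨fun t => (hmeas t).indicator (hAm t), fun s t hst' => ?_⟩
  refine (ae_eq_condExp_of_forall_setIntegral_eq (ℱ.le s)
    ((hint t).indicator (ℱ.le 0 _ hA)) (fun _ _ _ =>
      ((hint s).indicator (ℱ.le 0 _ hA)).integrableOn) (fun B hB _ => ?_)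
    ((hmeas s).indicator (hAm s)).aestronglyMeasurable).symm
  rw [setIntegral_indicator (ℱ.le 0 _ hA), setIntegral_indicator (ℱ.le 0 _ hA)]
  have hBA : MeasurableSet[ℱ s] (B ∩ A) := hB.inter (hAm s)
  generalize B ∩ A = C at hBA
  classical
  have hpw : IsStoppingTime ℱ fun ω =>
      ((min (ρ ω) (C.piecewise (fun _ => s) (fun _ => t) ω) : ℝ≥0) : WithTop ℝ≥0) := by
    have := hρ.min (isStoppingTime_piecewise_const hst' hBA)
    convert this using 2 with ω
    by_cases h : ω ∈ C
    · simp only [piecewise_eq_of_mem _ _ _ h, WithTop.coe_min]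
    · simp only [piecewise_eq_of_notMem _ _ _ h, WithTop.coe_min]
  have h1 := optional_stopping hM hMc (T := t) hpw (fun ω => (min_le_right _ _).trans (by
    by_cases h : ω ∈ C <;> simp [h, hst']))
  have h2 := optional_stopping hM hMc (T := t) (hst t) (fun ω => min_le_right _ _)
  have h3 := h1.2.1.trans h2.2.1.symm
  have hCm := ℱ.le s _ hBA
  rw [← integral_add_compl hCm h1.1, ← integral_add_compl hCm h2.1] at h3
  rw [setIntegral_congr_fun (g := fun ω => M (min (ρ ω) s) ω) hCm
      (fun ω hω => by simp [hω]),
    setIntegral_congr_fun (g := fun ω => M (min (ρ ω) t) ω) hCm.compl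
      (fun ω hω => by simp [show ω ∉ C from hω])] at h3
  linarith

theorem measurableSet_exists_le_of_continuous {Ω : Type*} {m : MeasurableSpace Ω}
    {ℱ : Filtration ℝ≥0 m} {D : ℝ≥0 → Ω → ℝ} (hD : StronglyAdapted ℱ D)
    (hDc : ∀ ω, Continuous fun t => D t ω) (K : ℝ) (t : ℝ≥0) :
    MeasurableSet[ℱ t] {ω | ∃ s ≤ t, K ≤ D s ω} := by
  have : {ω | ∃ s ≤ t, K ≤ D s ω} = ⋂ n : ℕ, ⋃ k : ℕ,
      {ω | K - 1 / ((n : ℝ) + 1) < D (min (TopologicalSpace.denseSeq ℝ≥0 k) t) ω} := by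
    ext ω
    simp only [mem_ofPred_eq, mem_iInter, mem_iUnion]
    constructor
    · rintro ⟨s, hst, hs⟩ n
      have hc : Continuous fun u : ℝ≥0 => D (min u t) ω :=
        (hDc ω).comp (continuous_id.min continuous_const)
      obtain ⟨k, hk⟩ := (TopologicalSpace.denseRange_denseSeq ℝ≥0).exists_mem_open
        (isOpen_lt (continuous_const (y := K - 1 / ((n : ℝ) + 1))) hc) ⟨s, by
          rw [mem_ofPred_eq, min_eq_left hst]
          have : (0 : ℝ) < 1 / ((n : ℝ) + 1) := by positivity
          linarith⟩
      exact ⟨k, hk⟩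
    · intro h
      obtain ⟨s, hs, hmax⟩ := (isCompact_Icc (a := (0 : ℝ≥0)) (b := t)).exists_isMaxOn
        (nonempty_Icc.2 zero_le) (hDc ω).continuousOn
      refine ⟨s, hs.2, ?_⟩
      by_contra! hlt
      obtain ⟨n, hn⟩ := exists_nat_one_div_lt (sub_pos.2 hlt)
      obtain ⟨k, hk⟩ := h n
      have := isMaxOn_iff.1 hmax (min (TopologicalSpace.denseSeq ℝ≥0 k) t)
        ⟨zero_le, min_le_right _ _⟩
      linarith
  rw [this]
  exact MeasurableSet.iInter fun n => MeasurableSet.iUnion fun k =>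
    @measurableSet_lt _ _ _ _ _ (ℱ t) _ _ _ _ _ measurable_const
      (((hD _).mono (ℱ.mono (min_le_right _ _))).measurable)

theorem exists_stoppingTime_le_of_continuous {Ω : Type*} {m : MeasurableSpace Ω}
    {ℱ : Filtration ℝ≥0 m} {D : ℝ≥0 → Ω → ℝ} (hD : StronglyAdapted ℱ D)
    (hDc : ∀ ω, Continuous fun t => D t ω) (K : ℝ) (T : ℝ≥0) :
    ∃ ρ : Ω → ℝ≥0, IsStoppingTime ℱ (fun ω => (ρ ω : WithTop ℝ≥0)) ∧
      (∀ ω, D 0 ω ≤ K → ∀ s ≤ ρ ω, D s ω ≤ K) ∧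
      ∀ ω, (∀ s ≤ T, D s ω < K) → ρ ω = T := by
  let S : Ω → Set ℝ≥0 := fun ω => insert T {t | t ≤ T ∧ K ≤ D t ω}
  have hSc : ∀ ω, IsClosed (S ω) := fun ω => by
    have : IsClosed {t | t ≤ T ∧ K ≤ D t ω} :=
      (isClosed_le continuous_id continuous_const).inter (isClosed_le continuous_const (hDc ω))
    exact isClosed_singleton.union this
  have hmem : ∀ ω, sInf (S ω) ∈ S ω := fun ω =>
    (hSc ω).csInf_mem ⟨T, mem_insert _ _⟩ (OrderBot.bddBelow _)
  have hle : ∀ ω t, t ∈ S ω → sInf (S ω) ≤ t := fun ω t ht => csInf_le (OrderBot.bddBelow _) ht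
  refine ⟨fun ω => sInf (S ω), fun t => ?_, fun ω h0 s hs => ?_, fun ω h => ?_⟩
  · by_cases hT : T ≤ t
    · have : {ω | ((sInf (S ω) : ℝ≥0) : WithTop ℝ≥0) ≤ t} = univ := by
        ext ω
        simp only [mem_ofPred_eq, WithTop.coe_le_coe, mem_univ, iff_true]
        exact (hle ω T (mem_insert _ _)).trans hT
      rw [this]
      exact @MeasurableSet.univ _ (ℱ t)
    · have : {ω | ((sInf (S ω) : ℝ≥0) : WithTop ℝ≥0) ≤ t} = {ω | ∃ s ≤ t, K ≤ D s ω} := by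
        ext ω
        simp only [mem_ofPred_eq, WithTop.coe_le_coe]
        constructor
        · intro h
          rcases hmem ω with h' | h'
          · exact absurd (h' ▸ h) hT
          · exact ⟨_, h, h'.2⟩
        · rintro ⟨s, hs, hK⟩
          exact (hle ω s (Or.inr ⟨hs.trans (not_le.1 hT).le, hK⟩)).trans hs
      rw [this]
      exact measurableSet_exists_le_of_continuous hD hDc K t
  · have hlt : ∀ u < sInf (S ω), D u ω ≤ K := fun u hu => by
      by_contra! hK
      have hT := hle ω T (mem_insert _ _)
      exact absurd (hle ω u (Or.inr ⟨(hu.trans_le hT).le, hK.le⟩)) (not_le.2 hu)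
    rcases eq_or_ne (sInf (S ω)) 0 with hz | hz
    · have : s = 0 := le_antisymm (hs.trans hz.le) zero_le
      exact this ▸ h0
    · have hcl : closure (Iio (sInf (S ω))) ⊆ {u | D u ω ≤ K} :=
        closure_minimal hlt (isClosed_le (hDc ω) continuous_const)
      rw [closure_Iio' ⟨0, pos_iff_ne_zero.2 hz⟩] at hcl
      exact hcl hs
  · rcases hmem ω with h' | h'
    · exact h'
    · exact absurd (h _ h'.1) (not_lt.2 h'.2)

theorem integral_mul_martingale_sub_eq_zero {Ω : Type*} {m : MeasurableSpace Ω} {P : Measure Ω}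
    [IsProbabilityMeasure P] {ℱ : Filtration ℝ≥0 m} {M : ℝ≥0 → Ω → ℝ} (hM : Martingale M ℱ P)
    {s t : ℝ≥0} (hst : s ≤ t) {f : Ω → ℝ} (hf : StronglyMeasurable[ℱ s] f) {c : ℝ}
    (hc : ∀ ω, |f ω| ≤ c) : ∫ ω, f ω * (M t ω - M s ω) ∂P = 0 := by
  have hi : Integrable (M t - M s) P := (hM.integrable t).sub (hM.integrable s)
  have h1 := condExp_stronglyMeasurable_mul_of_bound (ℱ.le s) hf hi c (ae_of_all _ hc)
  have h2 : P[M t - M s | ℱ s] =ᵐ[P] 0 := by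
    have h3 := condExp_sub (hM.integrable t) (hM.integrable s) (ℱ s)
    filter_upwards [h3, hM.2 s t hst, hM.2 s s le_rfl] with ω a b c
    simp [a, b, c]
  have h4 : ∫ ω, f ω * (M t ω - M s ω) ∂P = ∫ ω, (P[f * (M t - M s) | ℱ s]) ω ∂P := by
    rw [integral_condExp (ℱ.le s)]
    rfl
  rw [h4]
  refine integral_eq_zero_of_ae ?_
  filter_upwards [h1, h2] with ω a b
  simp [a, b]

theorem integrable_mul_martingale_sub {Ω : Type*} {m : MeasurableSpace Ω} {P : Measure Ω}
    [IsProbabilityMeasure P] {ℱ : Filtration ℝ≥0 m} {M : ℝ≥0 → Ω → ℝ} (hM : Martingale M ℱ P)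
    (s t : ℝ≥0) {f : Ω → ℝ} (hf : StronglyMeasurable[ℱ s] f) {c : ℝ}
    (hc : ∀ ω, |f ω| ≤ c) : Integrable (fun ω => f ω * (M t ω - M s ω)) P :=
  ((hM.integrable t).sub (hM.integrable s)).bdd_mul (hf.mono (ℱ.le s)).aestronglyMeasurable
    (ae_of_all _ hc)

theorem integrable_of_abs_le {Ω : Type*} {m : MeasurableSpace Ω} {P : Measure Ω}
    [IsProbabilityMeasure P] {f : Ω → ℝ} (hf : Measurable f) {c : ℝ} (hc : ∀ ω, |f ω| ≤ c) :
    Integrable f P :=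
  Integrable.of_bound hf.aestronglyMeasurable c (ae_of_all _ hc)

/-- The sums of squared increments of a bounded martingale are bounded in `L²`. -/
theorem integral_sq_sum_sq_increments_le {Ω : Type*} {m : MeasurableSpace Ω} {P : Measure Ω}
    [IsProbabilityMeasure P] {ℱ : Filtration ℝ≥0 m} {M : ℝ≥0 → Ω → ℝ} (hM : Martingale M ℱ P)
    {K : ℝ} (hK : ∀ t ω, |M t ω| ≤ K) {τ : ℕ → ℝ≥0} (hτ : Monotone τ) (n : ℕ) :
    Integrable (fun ω => (∑ i ∈ Finset.range n, (M (τ (i + 1)) ω - M (τ i) ω) ^ 2) ^ 2) P ∧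
    ∫ ω, (∑ i ∈ Finset.range n, (M (τ (i + 1)) ω - M (τ i) ω) ^ 2) ^ 2 ∂P ≤ 6 * K ^ 4 := by
  set S : ℕ → Ω → ℝ := fun n ω => ∑ i ∈ Finset.range n, (M (τ (i + 1)) ω - M (τ i) ω) ^ 2 with hS
  have hmeas : ∀ t, Measurable (M t) := fun t => ((hM.1 t).mono (ℱ.le t)).measurable
  have hK2 : ∀ t ω, M t ω ^ 2 ≤ K ^ 2 := fun t ω => sq_le_sq' (abs_le.1 (hK t ω)).1
    (abs_le.1 (hK t ω)).2
  have hd2 : ∀ s t ω, (M s ω - M t ω) ^ 2 ≤ 4 * K ^ 2 := fun s t ω => by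
    nlinarith [hK2 s ω, hK2 t ω, sq_nonneg (M s ω + M t ω)]
  have hSm : ∀ k n, n ≤ k → Measurable[ℱ (τ k)] (S n) := fun k n hn => by
    refine Finset.measurable_fun_sum _ fun i hi => ?_
    have hi' := Finset.mem_range.1 hi
    have h : ∀ j ≤ k, Measurable[ℱ (τ k)] fun ω => M (τ j) ω := fun j hj =>
      ((hM.1 _).mono (ℱ.mono (hτ hj))).measurable
    exact ((h (i + 1) (by omega)).sub (h i (by omega))).pow_const 2
  have hS0 : ∀ n ω, 0 ≤ S n ω := fun n ω => Finset.sum_nonneg fun i _ => sq_nonneg _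
  have hSb : ∀ n ω, S n ω ≤ n * (4 * K ^ 2) := fun n ω => by
    refine (Finset.sum_le_card_nsmul _ _ (4 * K ^ 2) fun i _ => hd2 _ _ ω).trans ?_
    simp
  have hSmeas : ∀ n, Measurable (S n) := fun n => (hSm n n le_rfl).mono (ℱ.le _) le_rfl
  have hSi : ∀ n, Integrable (S n) P := fun n => integrable_of_abs_le (hSmeas n)
    (c := n * (4 * K ^ 2)) fun ω => by rw [abs_of_nonneg (hS0 n ω)]; exact hSb n ω
  have hS2i : ∀ n, Integrable (fun ω => S n ω ^ 2) P := fun n =>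
    integrable_of_abs_le ((hSmeas n).pow_const 2) (c := (n * (4 * K ^ 2)) ^ 2) fun ω => by
      rw [abs_of_nonneg (sq_nonneg _)]
      exact pow_le_pow_left₀ (hS0 n ω) (hSb n ω) 2
  have hM2i : ∀ t, Integrable (fun ω => M t ω ^ 2) P := fun t =>
    integrable_of_abs_le ((hmeas t).pow_const 2) (c := K ^ 2) fun ω => by
      rw [abs_of_nonneg (sq_nonneg _)]; exact hK2 t ω
  have hSM : ∀ n t, Integrable (fun ω => S n ω * M t ω ^ 2) P := fun n t =>
    integrable_of_abs_le ((hSmeas n).mul ((hmeas t).pow_const 2)) (c := n * (4 * K ^ 2) * K ^ 2)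
      fun ω => by
        rw [abs_of_nonneg (mul_nonneg (hS0 n ω) (sq_nonneg _))]
        exact mul_le_mul (hSb n ω) (hK2 t ω) (sq_nonneg _) ((hS0 n ω).trans (hSb n ω))
  have hMM : ∀ s t, Integrable (fun ω => M s ω * (M t ω - M s ω)) P := fun s t =>
    integrable_of_abs_le ((hmeas s).mul ((hmeas t).sub (hmeas s))) (c := 4 * K ^ 2) fun ω => by
      rw [abs_le]
      constructor <;> nlinarith [hK2 s ω, hK2 t ω, sq_nonneg (M s ω + M t ω),
        sq_nonneg (M s ω - M t ω)]
  have hSMb : ∀ n t ω, |S n ω * M t ω| ≤ n * (4 * K ^ 2) * K := fun n t ω => by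
    rw [abs_mul, abs_of_nonneg (hS0 n ω)]
    exact mul_le_mul (hSb n ω) (hK t ω) (abs_nonneg _) ((hS0 n ω).trans (hSb n ω))
  have hSMM : ∀ n s t, Integrable (fun ω => S n ω * M s ω * (M t ω - M s ω)) P := fun n s t =>
    integrable_of_abs_le (((hSmeas n).mul (hmeas s)).mul ((hmeas t).sub (hmeas s)))
      (c := n * (4 * K ^ 2) * (4 * K ^ 2)) fun ω => by
      have : |M s ω * (M t ω - M s ω)| ≤ 4 * K ^ 2 := by
        rw [abs_le]
        constructor <;> nlinarith [hK2 s ω, hK2 t ω, sq_nonneg (M s ω + M t ω),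
          sq_nonneg (M s ω - M t ω)]
      rw [mul_assoc, abs_mul, abs_of_nonneg (hS0 n ω)]
      exact mul_le_mul (hSb n ω) this (abs_nonneg _) ((hS0 n ω).trans (hSb n ω))
  have hsucc : ∀ n ω, S (n + 1) ω = S n ω + (M (τ (n + 1)) ω - M (τ n) ω) ^ 2 := fun n ω => by
    simp only [hS, Finset.sum_range_succ]
  have h1 : ∀ n, ∫ ω, (S n ω - M (τ n) ω ^ 2) ∂P = -∫ ω, M (τ 0) ω ^ 2 ∂P := by
    intro n
    induction n with
    | zero => simp [hS, integral_neg]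
    | succ n ih =>
      rw [← ih]
      have h0 := integral_mul_martingale_sub_eq_zero hM (hτ n.le_succ) (hM.1 (τ n)) (hK (τ n))
      have : ∀ ω, S (n + 1) ω - M (τ (n + 1)) ω ^ 2 = (S n ω - M (τ n) ω ^ 2) -
          2 * (M (τ n) ω * (M (τ (n + 1)) ω - M (τ n) ω)) := fun ω => by rw [hsucc]; ring
      simp_rw [this]
      have hi : Integrable (fun ω => S n ω - M (τ n) ω ^ 2) P := (hSi n).sub (hM2i _)
      rw [integral_sub hi ((hMM _ _).const_mul 2), integral_const_mul]
      simp only [Nat.succ_eq_add_one] at h0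
      rw [h0]; ring
  have h2 : ∀ n, ∫ ω, (S n ω ^ 2 - 2 * (S n ω * M (τ n) ω ^ 2) - 4 * K ^ 2 * S n ω) ∂P ≤ 0 := by
    intro n
    induction n with
    | zero => simp [hS]
    | succ n ih =>
      have h0 := integral_mul_martingale_sub_eq_zero hM (hτ n.le_succ)
        ((hSm n n le_rfl).stronglyMeasurable.mul (hM.1 (τ n))) (hSMb n (τ n))
      simp only [Nat.succ_eq_add_one, Pi.mul_apply] at h0
      have hGi : ∀ n, Integrable
          (fun ω => S n ω ^ 2 - 2 * (S n ω * M (τ n) ω ^ 2) - 4 * K ^ 2 * S n ω) P := fun n =>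
        ((hS2i n).sub ((hSM n _).const_mul 2)).sub ((hSi n).const_mul _)
      calc _ ≤ ∫ ω, ((S n ω ^ 2 - 2 * (S n ω * M (τ n) ω ^ 2) - 4 * K ^ 2 * S n ω) -
            4 * (S n ω * M (τ n) ω * (M (τ (n + 1)) ω - M (τ n) ω))) ∂P := by
            refine integral_mono (hGi _) ((hGi n).sub ((hSMM _ _ _).const_mul 4)) fun ω => ?_
            simp only [hsucc]
            have ha := hd2 (τ (n + 1)) (τ n) ω
            have hb := hS0 n ω
            generalize S n ω = s at hb ⊢
            generalize M (τ (n + 1)) ω = y at ha ⊢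
            generalize M (τ n) ω = x at ha ⊢
            nlinarith [mul_nonneg (sq_nonneg (y - x)) (sub_nonneg.2 ha),
              mul_nonneg (sq_nonneg (y - x)) (sq_nonneg y)]
        _ = ∫ ω, (S n ω ^ 2 - 2 * (S n ω * M (τ n) ω ^ 2) - 4 * K ^ 2 * S n ω) ∂P := by
            rw [integral_sub (hGi n) ((hSMM _ _ _).const_mul 4), integral_const_mul, h0]
            ring
        _ ≤ 0 := ih
  refine ⟨hS2i n, ?_⟩
  have h1' := h1 n
  have h2' := h2 n
  rw [integral_sub (hSi n) (hM2i _)] at h1'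
  have hMK : ∫ ω, M (τ n) ω ^ 2 ∂P ≤ K ^ 2 := by
    have := integral_mono (hM2i (τ n)) (integrable_const (K ^ 2)) (fun ω => hK2 (τ n) ω)
    simpa using this
  have hM0 : 0 ≤ ∫ ω, M (τ 0) ω ^ 2 ∂P := integral_nonneg fun ω => sq_nonneg _
  have hSK : ∫ ω, S n ω ∂P ≤ K ^ 2 := by
    linarith
  have h3 : ∫ ω, S n ω * M (τ n) ω ^ 2 ∂P ≤ K ^ 2 * ∫ ω, S n ω ∂P := by
    rw [← integral_const_mul]
    refine integral_mono (hSM n _) ((hSi n).const_mul _) fun ω => ?_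
    simp only
    rw [mul_comm]
    exact mul_le_mul_of_nonneg_right (hK2 _ ω) (hS0 n ω)
  have hi : Integrable (fun ω => S n ω ^ 2 - 2 * (S n ω * M (τ n) ω ^ 2)) P :=
    (hS2i n).sub ((hSM n _).const_mul 2)
  rw [integral_sub hi ((hSi n).const_mul _), integral_sub (hS2i n) ((hSM n _).const_mul 2),
    integral_const_mul, integral_const_mul] at h2'
  have h4 := mul_le_mul_of_nonneg_left hSK (sq_nonneg K)
  change ∫ ω, S n ω ^ 2 ∂P ≤ _
  nlinarith

theorem exists_abs_le_of_continuous {F : ℝ → ℝ → ℝ} (hF : Continuous fun z : ℝ × ℝ => F z.1 z.2)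
    (K : ℝ) : ∃ C, ∀ x y, |x| ≤ K → |y| ≤ K → |F x y| ≤ C := by
  obtain ⟨C, hC⟩ := ((isCompact_Icc (a := -K) (b := K)).prod
    (isCompact_Icc (a := -K) (b := K))).exists_bound_of_continuousOn hF.continuousOn
  exact ⟨C, fun x y hx hy => hC (x, y) ⟨abs_le.1 hx, abs_le.1 hy⟩⟩

theorem integral_comp_sub_le_of_taylor {Ω : Type*} {m : MeasurableSpace Ω} {P : Measure Ω}
    [IsProbabilityMeasure P] {ℱ : Filtration ℝ≥0 m} {X Y QX QY : ℝ≥0 → Ω → ℝ}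
    (hX : Martingale X ℱ P) (hY : Martingale Y ℱ P)
    (hQX : Martingale (fun t ω => X t ω ^ 2 - QX t ω) ℱ P)
    (hQY : Martingale (fun t ω => Y t ω ^ 2 - QY t ω) ℱ P)
    (hsub : ∀ ω, Monotone fun t => QX t ω - QY t ω)
    {K : ℝ} (hXK : ∀ t ω, |X t ω| ≤ K) (hYK : ∀ t ω, |Y t ω| ≤ K)
    {U φ ψ c : ℝ → ℝ → ℝ} {L : ℝ}
    (hU : Continuous fun z : ℝ × ℝ => U z.1 z.2) (hφ : Continuous fun z : ℝ × ℝ => φ z.1 z.2)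
    (hψ : Continuous fun z : ℝ × ℝ => ψ z.1 z.2) (hc : Continuous fun z : ℝ × ℝ => c z.1 z.2)
    (hc0 : ∀ x y, 0 ≤ c x y)
    (htaylor : ∀ x y x' y', |x| ≤ K → |y| ≤ K → |x'| ≤ K → |y'| ≤ K →
      U x' y' ≤ U x y + φ x y * (x' - x) + ψ x y * (y' - y) -
        c x y * ((x' - x) ^ 2 - (y' - y) ^ 2) +
        L * ((|x' - x| + |y' - y|) * ((x' - x) ^ 2 + (y' - y) ^ 2)))
    {s t : ℝ≥0} (hst : s ≤ t) :
    ∫ ω, U (X t ω) (Y t ω) ∂P - ∫ ω, U (X s ω) (Y s ω) ∂P ≤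
      L * ∫ ω, (|X t ω - X s ω| + |Y t ω - Y s ω|) *
        ((X t ω - X s ω) ^ 2 + (Y t ω - Y s ω) ^ 2) ∂P := by
  have hXm : ∀ t, Measurable (X t) := fun t => ((hX.1 t).mono (ℱ.le t)).measurable
  have hYm : ∀ t, Measurable (Y t) := fun t => ((hY.1 t).mono (ℱ.le t)).measurable
  have hcomp : ∀ {F : ℝ → ℝ → ℝ}, (Continuous fun z : ℝ × ℝ => F z.1 z.2) → ∀ t,
      StronglyMeasurable[ℱ t] fun ω => F (X t ω) (Y t ω) := fun {F} hF t =>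
    hF.comp_stronglyMeasurable ((hX.1 t).prodMk (hY.1 t))
  have hint : ∀ {F : ℝ → ℝ → ℝ}, (Continuous fun z : ℝ × ℝ => F z.1 z.2) → ∀ t,
      Integrable (fun ω => F (X t ω) (Y t ω)) P := fun {F} hF t => by
    obtain ⟨C, hC⟩ := exists_abs_le_of_continuous hF K
    exact integrable_of_abs_le ((hcomp hF t).mono (ℱ.le t)).measurable
      fun ω => hC _ _ (hXK t ω) (hYK t ω)
  have hzero : ∀ {F : ℝ → ℝ → ℝ}, (Continuous fun z : ℝ × ℝ => F z.1 z.2) →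
      ∀ {M : ℝ≥0 → Ω → ℝ}, Martingale M ℱ P →
      Integrable (fun ω => F (X s ω) (Y s ω) * (M t ω - M s ω)) P ∧
      ∫ ω, F (X s ω) (Y s ω) * (M t ω - M s ω) ∂P = 0 := fun {F} hF {M} hM => by
    obtain ⟨C, hC⟩ := exists_abs_le_of_continuous hF K
    exact ⟨integrable_mul_martingale_sub hM s t (hcomp hF s)
        fun ω => hC _ _ (hXK s ω) (hYK s ω),
      integral_mul_martingale_sub_eq_zero hM hst (hcomp hF s)
        fun ω => hC _ _ (hXK s ω) (hYK s ω)⟩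
  obtain ⟨i1, e1⟩ := hzero (F := fun x y => φ x y + 2 * c x y * x) (by fun_prop) hX
  obtain ⟨i2, e2⟩ := hzero (F := fun x y => ψ x y - 2 * c x y * y) (by fun_prop) hY
  obtain ⟨i3, e3⟩ := hzero hc hQX
  obtain ⟨i4, e4⟩ := hzero hc hQY
  have i5 : Integrable (fun ω => (|X t ω - X s ω| + |Y t ω - Y s ω|) *
        ((X t ω - X s ω) ^ 2 + (Y t ω - Y s ω) ^ 2)) P := by
    have hXt := hXm t
    have hXs := hXm s
    have hYt := hYm t
    have hYs := hYm s
    refine integrable_of_abs_le (c := (4 * K) * (8 * K ^ 2)) (by fun_prop) fun ω => ?_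
    have hd : ∀ a b : ℝ, |a| ≤ K → |b| ≤ K → |a - b| ≤ 2 * K ∧ (a - b) ^ 2 ≤ 4 * K ^ 2 := by
      intro a b ha hb
      have h1 : |a - b| ≤ 2 * K := by linarith [abs_sub a b]
      refine ⟨h1, ?_⟩
      rw [← sq_abs]
      nlinarith [abs_nonneg (a - b)]
    have h1 := hd _ _ (hXK t ω) (hXK s ω)
    have h2 := hd _ _ (hYK t ω) (hYK s ω)
    rw [abs_of_nonneg (by positivity)]
    refine mul_le_mul (by linarith) (by linarith) (by positivity) ?_
    linarith [abs_nonneg (X t ω), hXK t ω]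
  have hmain : ∫ ω, U (X t ω) (Y t ω) ∂P ≤ ∫ ω, (U (X s ω) (Y s ω) +
      (φ (X s ω) (Y s ω) + 2 * c (X s ω) (Y s ω) * X s ω) * (X t ω - X s ω) +
      (ψ (X s ω) (Y s ω) - 2 * c (X s ω) (Y s ω) * Y s ω) * (Y t ω - Y s ω) -
      c (X s ω) (Y s ω) * (X t ω ^ 2 - QX t ω - (X s ω ^ 2 - QX s ω)) +
      c (X s ω) (Y s ω) * (Y t ω ^ 2 - QY t ω - (Y s ω ^ 2 - QY s ω)) +
      L * ((|X t ω - X s ω| + |Y t ω - Y s ω|) *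
        ((X t ω - X s ω) ^ 2 + (Y t ω - Y s ω) ^ 2))) ∂P := by
    refine integral_mono (hint hU t)
      ((((((hint hU s).add i1).add i2).sub i3).add i4).add (i5.const_mul L)) fun ω => ?_
    have h1 := htaylor _ _ _ _ (hXK s ω) (hYK s ω) (hXK t ω) (hYK t ω)
    have h2 := mul_nonneg (hc0 (X s ω) (Y s ω)) (sub_nonneg.2 (hsub ω hst))
    simp only at h2 ⊢
    linarith
  have j1 : Integrable (fun ω => U (X s ω) (Y s ω) +
      (φ (X s ω) (Y s ω) + 2 * c (X s ω) (Y s ω) * X s ω) * (X t ω - X s ω)) P :=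
    (hint hU s).add i1
  have j2 := j1.add i2
  have j3 := j2.sub i3
  have j4 := j3.add i4
  simp only [Pi.add_def, Pi.sub_def] at j2 j3 j4
  rw [integral_add j4 (i5.const_mul L), integral_add j3 i4, integral_sub j2 i3,
    integral_add j1 i2, integral_add (hint hU s) i1, e1, e2, e3, e4, integral_const_mul] at hmain
  linarith

theorem eventually_abs_increment_lt {f : ℝ≥0 → ℝ} (hf : Continuous f) (T : ℝ≥0) {ε : ℝ}
    (hε : 0 < ε) : ∀ᶠ N : ℕ in atTop, ∀ i ≤ N,
      |f (T * ((i + 1 : ℕ) : ℝ≥0) / (N + 1)) - f (T * (i : ℝ≥0) / (N + 1))| < ε := by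
  have huc := (isCompact_Icc (a := (0 : ℝ≥0)) (b := T)).uniformContinuousOn_of_continuous
    hf.continuousOn
  obtain ⟨δ, hδ, h⟩ := Metric.uniformContinuousOn_iff.1 huc ε hε
  have hlim : Tendsto (fun N : ℕ => (T : ℝ) / ((N : ℝ) + 1)) atTop (𝓝 0) :=
    tendsto_const_div_atTop_nhds_zero_nat (T : ℝ) |>.comp (tendsto_add_atTop_nat 1) |>.congr
      fun N => by simp
  have hmem : ∀ i N : ℕ, i ≤ N + 1 → T * (i : ℝ≥0) / (N + 1) ∈ Icc (0 : ℝ≥0) T := by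
    intro i N hi
    refine ⟨by simp, div_le_of_le_mul₀ (by simp) (by simp) ?_⟩
    gcongr
    exact_mod_cast hi
  filter_upwards [hlim.eventually_lt_const hδ] with N hN i hi
  refine h _ (hmem _ _ (by omega)) _ (hmem _ _ (by omega)) ?_
  rw [NNReal.dist_eq]
  push_cast
  have : (T : ℝ) * (i + 1) / (N + 1) - T * i / (N + 1) = T / (N + 1) := by ring
  rw [this, abs_of_nonneg (by positivity)]
  exact hN

theorem integral_comp_le_of_taylor {Ω : Type*} {m : MeasurableSpace Ω} {P : Measure Ω}
    [IsProbabilityMeasure P] {ℱ : Filtration ℝ≥0 m} {X Y QX QY : ℝ≥0 → Ω → ℝ}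
    (hX : Martingale X ℱ P) (hY : Martingale Y ℱ P)
    (hXc : ∀ ω, Continuous fun t => X t ω) (hYc : ∀ ω, Continuous fun t => Y t ω)
    (hQX : Martingale (fun t ω => X t ω ^ 2 - QX t ω) ℱ P)
    (hQY : Martingale (fun t ω => Y t ω ^ 2 - QY t ω) ℱ P)
    (hsub : ∀ ω, Monotone fun t => QX t ω - QY t ω)
    {K : ℝ} (hXK : ∀ t ω, |X t ω| ≤ K) (hYK : ∀ t ω, |Y t ω| ≤ K)
    {U φ ψ c : ℝ → ℝ → ℝ} {L : ℝ} (hL : 0 ≤ L)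
    (hU : Continuous fun z : ℝ × ℝ => U z.1 z.2) (hφ : Continuous fun z : ℝ × ℝ => φ z.1 z.2)
    (hψ : Continuous fun z : ℝ × ℝ => ψ z.1 z.2) (hc : Continuous fun z : ℝ × ℝ => c z.1 z.2)
    (hc0 : ∀ x y, 0 ≤ c x y)
    (htaylor : ∀ x y x' y', |x| ≤ K → |y| ≤ K → |x'| ≤ K → |y'| ≤ K →
      U x' y' ≤ U x y + φ x y * (x' - x) + ψ x y * (y' - y) -
        c x y * ((x' - x) ^ 2 - (y' - y) ^ 2) +
        L * ((|x' - x| + |y' - y|) * ((x' - x) ^ 2 + (y' - y) ^ 2)))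
    (T : ℝ≥0) :
    ∫ ω, U (X T ω) (Y T ω) ∂P ≤ ∫ ω, U (X 0 ω) (Y 0 ω) ∂P := by
  have hXm : ∀ t, Measurable (X t) := fun t => ((hX.1 t).mono (ℱ.le t)).measurable
  have hYm : ∀ t, Measurable (Y t) := fun t => ((hY.1 t).mono (ℱ.le t)).measurable
  have hdiff : ∀ {M : ℝ≥0 → Ω → ℝ}, (∀ t ω, |M t ω| ≤ K) → ∀ s t ω,
      |M t ω - M s ω| ≤ 2 * K := fun {M} hM s t ω => by
    linarith [abs_sub (M t ω) (M s ω), hM t ω, hM s ω]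
  set τ : ℕ → ℕ → ℝ≥0 := fun N i => T * (i : ℝ≥0) / (N + 1) with hτdef
  have hτ : ∀ N, Monotone (τ N) := fun N i j hij => by
    simp only [hτdef]
    gcongr
  set inc : ℕ → ℕ → Ω → ℝ := fun N i ω =>
    |X (τ N (i + 1)) ω - X (τ N i) ω| + |Y (τ N (i + 1)) ω - Y (τ N i) ω| with hinc
  have hincm : ∀ N i, Measurable (inc N i) := fun N i => by
    have h1 := hXm (τ N (i + 1))
    have h2 := hXm (τ N i)
    have h3 := hYm (τ N (i + 1))
    have h4 := hYm (τ N i)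
    simp only [hinc]
    fun_prop
  set w : ℕ → Ω → ℝ := fun N ω =>
    (Finset.range (N + 1)).sup' Finset.nonempty_range_add_one (fun i => inc N i ω) with hw
  have hwm : ∀ N, Measurable (w N) := fun N => by
    have := Finset.measurable_sup' (s := Finset.range (N + 1)) Finset.nonempty_range_add_one
      (f := fun i => inc N i) fun i _ => hincm N i
    convert this using 1
    ext ω
    simp [hw, Finset.sup'_apply]
  have hle_w : ∀ N i ω, i ≤ N → inc N i ω ≤ w N ω := fun N i ω hi =>
    Finset.le_sup' (fun i => inc N i ω) (Finset.mem_range.2 (by omega))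
  have hinc0 : ∀ N i ω, 0 ≤ inc N i ω := fun N i ω => by positivity
  have hw0 : ∀ N ω, 0 ≤ w N ω := fun N ω => (hinc0 N 0 ω).trans (hle_w N 0 ω (Nat.zero_le _))
  have hw4 : ∀ N ω, w N ω ≤ 4 * K := fun N ω => Finset.sup'_le _ _ fun i _ => by
    linarith [hdiff hXK (τ N i) (τ N (i + 1)) ω, hdiff hYK (τ N i) (τ N (i + 1)) ω]
  have hwlim : ∀ ω, Tendsto (fun N => w N ω) atTop (𝓝 0) := fun ω => by
    rw [Metric.tendsto_atTop']
    intro ε hε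
    obtain ⟨N, hN⟩ := eventually_atTop.1 ((eventually_abs_increment_lt (hXc ω) T (half_pos hε)).and
      (eventually_abs_increment_lt (hYc ω) T (half_pos hε)))
    refine ⟨N, fun n hn => ?_⟩
    rw [Real.dist_eq, sub_zero, abs_of_nonneg (hw0 n ω)]
    refine (Finset.sup'_lt_iff _).2 fun i hi => ?_
    have hi' : i ≤ n := by simpa [Nat.lt_succ_iff] using hi
    have h1 := (hN n hn.le).1 i hi'
    have h2 := (hN n hn.le).2 i hi'
    simp only [hinc, hτdef]
    linarith
  have hw2m : ∀ N, Measurable fun ω => w N ω ^ 2 := fun N => (hwm N).pow_const 2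
  have hw2b : ∀ N ω, |w N ω ^ 2| ≤ (4 * K) ^ 2 := fun N ω => by
    rw [abs_of_nonneg (by positivity)]
    exact pow_le_pow_left₀ (hw0 N ω) (hw4 N ω) 2
  have hw2lim : Tendsto (fun N => ∫ ω, w N ω ^ 2 ∂P) atTop (𝓝 0) := by
    have := tendsto_integral_of_dominated_convergence (μ := P) (F := fun N ω => w N ω ^ 2)
      (f := fun _ => (0 : ℝ)) (fun _ => (4 * K) ^ 2)
      (fun N => (hw2m N).aestronglyMeasurable) (integrable_const _)
      (fun N => ae_of_all _ (hw2b N)) (ae_of_all _ fun ω => by simpa using (hwlim ω).pow 2)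
    simpa using this
  have hbound : ∀ lam : ℝ, 0 < lam → ∀ N, ∫ ω, U (X T ω) (Y T ω) ∂P -
      ∫ ω, U (X 0 ω) (Y 0 ω) ∂P ≤
      L * (lam * (12 * K ^ 4) + (2 * lam)⁻¹ * ∫ ω, w N ω ^ 2 ∂P) := by
    intro lam hlam N
    obtain ⟨iX, eX⟩ := integral_sq_sum_sq_increments_le hX hXK (hτ N) (N + 1)
    obtain ⟨iY, eY⟩ := integral_sq_sum_sq_increments_le hY hYK (hτ N) (N + 1)
    have iw : Integrable (fun ω => w N ω ^ 2) P := integrable_of_abs_le (hw2m N) (hw2b N)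
    have it : ∀ i, Integrable (fun ω => inc N i ω * ((X (τ N (i + 1)) ω - X (τ N i) ω) ^ 2 +
        (Y (τ N (i + 1)) ω - Y (τ N i) ω) ^ 2)) P := fun i => by
      have h1 := hXm (τ N (i + 1))
      have h2 := hXm (τ N i)
      have h3 := hYm (τ N (i + 1))
      have h4 := hYm (τ N i)
      have h5 := hincm N i
      refine integrable_of_abs_le (c := (4 * K) * (8 * K ^ 2)) (by fun_prop) fun ω => ?_
      have hsq : ∀ a : ℝ, |a| ≤ 2 * K → a ^ 2 ≤ 4 * K ^ 2 := fun a ha => by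
        rw [← sq_abs]
        nlinarith [abs_nonneg a]
      have hx := hdiff hXK (τ N i) (τ N (i + 1)) ω
      have hy := hdiff hYK (τ N i) (τ N (i + 1)) ω
      have hx2 := hsq _ hx
      have hy2 := hsq _ hy
      rw [abs_of_nonneg (mul_nonneg (hinc0 N i ω) (by positivity))]
      refine mul_le_mul (by simp only [hinc]; linarith) (by linarith) (by positivity) ?_
      linarith [abs_nonneg (X (τ N (i + 1)) ω - X (τ N i) ω)]
    have htel : ∫ ω, U (X T ω) (Y T ω) ∂P - ∫ ω, U (X 0 ω) (Y 0 ω) ∂P =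
        ∑ i ∈ Finset.range (N + 1), (∫ ω, U (X (τ N (i + 1)) ω) (Y (τ N (i + 1)) ω) ∂P -
          ∫ ω, U (X (τ N i) ω) (Y (τ N i) ω) ∂P) := by
      rw [Finset.sum_range_sub fun i => ∫ ω, U (X (τ N i) ω) (Y (τ N i) ω) ∂P]
      have h0 : τ N 0 = 0 := by simp [hτdef]
      have h1 : τ N (N + 1) = T := by
        simp only [hτdef]
        push_cast
        exact mul_div_cancel_right₀ _ (by positivity)
      rw [h0, h1]
    have hsum : ∑ i ∈ Finset.range (N + 1), ∫ ω, inc N i ω *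
        ((X (τ N (i + 1)) ω - X (τ N i) ω) ^ 2 + (Y (τ N (i + 1)) ω - Y (τ N i) ω) ^ 2) ∂P ≤
        lam * (12 * K ^ 4) + (2 * lam)⁻¹ * ∫ ω, w N ω ^ 2 ∂P := by
      rw [← integral_finsetSum _ fun i _ => it i]
      have hpt : ∫ ω, ∑ i ∈ Finset.range (N + 1), inc N i ω *
          ((X (τ N (i + 1)) ω - X (τ N i) ω) ^ 2 + (Y (τ N (i + 1)) ω - Y (τ N i) ω) ^ 2) ∂P ≤
          ∫ ω, (lam * ((∑ i ∈ Finset.range (N + 1), (X (τ N (i + 1)) ω - X (τ N i) ω) ^ 2) ^ 2 +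
            (∑ i ∈ Finset.range (N + 1), (Y (τ N (i + 1)) ω - Y (τ N i) ω) ^ 2) ^ 2) +
            (2 * lam)⁻¹ * w N ω ^ 2) ∂P := by
        refine integral_mono (integrable_finsetSum _ fun i _ => it i)
          (((iX.add iY).const_mul lam).add (iw.const_mul _)) fun ω => ?_
        have h1 : ∑ i ∈ Finset.range (N + 1), inc N i ω *
            ((X (τ N (i + 1)) ω - X (τ N i) ω) ^ 2 + (Y (τ N (i + 1)) ω - Y (τ N i) ω) ^ 2) ≤
            w N ω * (∑ i ∈ Finset.range (N + 1), (X (τ N (i + 1)) ω - X (τ N i) ω) ^ 2 +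
              ∑ i ∈ Finset.range (N + 1), (Y (τ N (i + 1)) ω - Y (τ N i) ω) ^ 2) := by
          rw [← Finset.sum_add_distrib, Finset.mul_sum]
          exact Finset.sum_le_sum fun i hi => mul_le_mul_of_nonneg_right
            (hle_w N i ω (by simpa [Nat.lt_succ_iff] using hi)) (by positivity)
        refine h1.trans ?_
        set a := ∑ i ∈ Finset.range (N + 1), (X (τ N (i + 1)) ω - X (τ N i) ω) ^ 2
        set b := ∑ i ∈ Finset.range (N + 1), (Y (τ N (i + 1)) ω - Y (τ N i) ω) ^ 2
        have h2 : lam * (a ^ 2 + b ^ 2) + (2 * lam)⁻¹ * w N ω ^ 2 - w N ω * (a + b) =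
            lam / 2 * (a - b) ^ 2 + (2 * lam)⁻¹ * (w N ω - lam * (a + b)) ^ 2 := by
          field_simp
          ring
        have h3 : 0 ≤ lam / 2 * (a - b) ^ 2 + (2 * lam)⁻¹ * (w N ω - lam * (a + b)) ^ 2 := by
          positivity
        linarith
      refine hpt.trans ?_
      have iXY := (iX.add iY).const_mul lam
      simp only [Pi.add_def] at iXY
      rw [integral_add iXY (iw.const_mul _), integral_const_mul, integral_const_mul,
        integral_add iX iY]
      have := mul_le_mul_of_nonneg_left (add_le_add eX eY) hlam.le
      linarith
    rw [htel]
    refine le_trans ?_ (mul_le_mul_of_nonneg_left hsum hL)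
    rw [Finset.mul_sum]
    exact Finset.sum_le_sum fun i _ => integral_comp_sub_le_of_taylor hX hY hQX hQY hsub hXK hYK
      hU hφ hψ hc hc0 htaylor (hτ N (Nat.le_succ i))
  have hlim : ∀ lam : ℝ, 0 < lam → ∫ ω, U (X T ω) (Y T ω) ∂P -
      ∫ ω, U (X 0 ω) (Y 0 ω) ∂P ≤ L * (lam * (12 * K ^ 4)) := by
    intro lam hlam
    refine ge_of_tendsto' (f := fun N : ℕ =>
      L * (lam * (12 * K ^ 4) + (2 * lam)⁻¹ * ∫ ω, w N ω ^ 2 ∂P)) (x := atTop) ?_ (hbound lam hlam)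
    simpa using ((hw2lim.const_mul (2 * lam)⁻¹).const_add (lam * (12 * K ^ 4))).const_mul L
  have h0 : ∫ ω, U (X T ω) (Y T ω) ∂P - ∫ ω, U (X 0 ω) (Y 0 ω) ∂P ≤ 0 := by
    refine ge_of_tendsto (f := fun lam : ℝ => L * (lam * (12 * K ^ 4))) (x := 𝓝[>] 0) ?_
      (eventually_mem_nhdsWithin.mono fun lam hlam => hlim lam hlam)
    have : Continuous fun lam : ℝ => L * (lam * (12 * K ^ 4)) := by fun_prop
    simpa using (this.tendsto 0).mono_left nhdsWithin_le_nhds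
  linarith

theorem le_add_add_half_of_deriv2_le {g g' g'' : ℝ → ℝ} (hg : ∀ θ, HasDerivAt g (g' θ) θ)
    (hg' : ∀ θ, HasDerivAt g' (g'' θ) θ) {B : ℝ} (hB : ∀ θ ∈ Icc (0 : ℝ) 1, g'' θ ≤ B) :
    g 1 ≤ g 0 + g' 0 + B / 2 := by
  have h1 : AntitoneOn (fun θ => g' θ - B * θ) (Icc 0 1) := by
    have hd : ∀ θ, HasDerivAt (fun θ => g' θ - B * θ) (g'' θ - B) θ := fun θ => by
      simpa using (hg' θ).fun_sub ((hasDerivAt_id θ).const_mul B)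
    refine antitoneOn_of_deriv_nonpos (convex_Icc 0 1)
      (fun θ _ => (hd θ).continuousAt.continuousWithinAt)
      (fun θ _ => (hd θ).differentiableAt.differentiableWithinAt) fun θ hθ => ?_
    rw [(hd θ).deriv]
    linarith [hB θ (interior_subset hθ)]
  have h2 : AntitoneOn (fun θ => g θ - g' 0 * θ - B / 2 * θ ^ 2) (Icc 0 1) := by
    have hd : ∀ θ, HasDerivAt (fun θ => g θ - g' 0 * θ - B / 2 * θ ^ 2)
        (g' θ - g' 0 - B * θ) θ := fun θ => by
      refine (((hg θ).fun_sub ((hasDerivAt_id θ).const_mul (g' 0))).fun_sub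
        ((hasDerivAt_pow 2 θ).const_mul (B / 2))).congr_deriv ?_
      push_cast
      ring
    refine antitoneOn_of_deriv_nonpos (convex_Icc 0 1)
      (fun θ _ => (hd θ).continuousAt.continuousWithinAt)
      (fun θ _ => (hd θ).differentiableAt.differentiableWithinAt) fun θ hθ => ?_
    rw [(hd θ).deriv]
    have hθ' := interior_subset hθ
    have := h1 (left_mem_Icc.2 zero_le_one) hθ' hθ'.1
    simp only [mul_zero, sub_zero] at this
    linarith
  have := h2 (left_mem_Icc.2 zero_le_one) (right_mem_Icc.2 zero_le_one) zero_le_one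
  simp only [mul_zero, mul_one, one_pow, sub_zero, ne_eq, OfNat.ofNat_ne_zero, not_false_eq_true,
    zero_pow] at this
  linarith

theorem abs_sqrt_sq_add_sq_sub_le {ε : ℝ} (hε : 0 < ε) (x y : ℝ) :
    |√(x ^ 2 + ε ^ 2) - √(y ^ 2 + ε ^ 2)| ≤ |x - y| := by
  have hx : 0 < √(x ^ 2 + ε ^ 2) := Real.sqrt_pos.2 (by positivity)
  have hy : 0 < √(y ^ 2 + ε ^ 2) := Real.sqrt_pos.2 (by positivity)
  have hx2 := Real.sq_sqrt (show 0 ≤ x ^ 2 + ε ^ 2 by positivity)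
  have hy2 := Real.sq_sqrt (show 0 ≤ y ^ 2 + ε ^ 2 by positivity)
  have hxa : |x| ≤ √(x ^ 2 + ε ^ 2) := Real.abs_le_sqrt (by nlinarith)
  have hya : |y| ≤ √(y ^ 2 + ε ^ 2) := Real.abs_le_sqrt (by nlinarith)
  set r := √(x ^ 2 + ε ^ 2)
  set s := √(y ^ 2 + ε ^ 2)
  have h1 : |r - s| * (r + s) = |x - y| * |x + y| := by
    rw [← abs_of_pos (add_pos hx hy), ← abs_mul, ← abs_mul]
    congr 1
    linarith
  have h2 : |x + y| ≤ r + s := (abs_add_le x y).trans (add_le_add hxa hya)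
  have h3 : |r - s| * (r + s) ≤ |x - y| * (r + s) := by
    rw [h1]
    gcongr
  exact le_of_mul_le_mul_right h3 (add_pos hx hy)

theorem burkholder_second_deriv_le {p r s r' s' r'' s'' h k v : ℝ} (hp : 1 < p) (hr : 0 ≤ r)
    (hs : 0 ≤ s) (hr'' : 0 ≤ r'') (hs'' : 0 ≤ s'') (hv : 0 ≤ v) (hh : h ^ 2 = r * r'' + r' ^ 2)
    (hk : k ^ 2 = s * s'' + s' ^ 2) :
    v * ((min 1 (p - 1) * s'' - max 1 (p - 1) * r'') * (r + s) ^ 2 +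
      2 * (p - 1) * (min 1 (p - 1) * s' - max 1 (p - 1) * r') * (r + s) * (r' + s') +
      (min 1 (p - 1) * s - max 1 (p - 1) * r) * ((p - 1) * (p - 2) * (r' + s') ^ 2 +
        (p - 1) * (r + s) * (r'' + s''))) ≤
      -(p * (p - 1) * (v * (r + s)) * (h ^ 2 - k ^ 2)) := by
  rw [hh, hk, ← sub_nonneg]
  have hp0 : 0 ≤ p := by linarith
  have hp1 : 0 ≤ p - 1 := by linarith
  rcases le_total 2 p with h2 | h2
  · rw [min_eq_left (by linarith), max_eq_right (by linarith)]
    have hp2 : 0 ≤ p - 2 := by linarith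
    have : 0 ≤ v * p * ((p - 2) * s'' * (r + s) ^ 2 + (p - 1) * (p - 2) * (r' + s') ^ 2 * r) := by
      positivity
    refine this.trans (le_of_eq ?_)
    ring
  · rw [min_eq_right (by linarith), max_eq_left (by linarith)]
    have hp2 : 0 ≤ 2 - p := by linarith
    have : 0 ≤ v * p * ((2 - p) * r'' * (r + s) ^ 2 + (p - 1) * (2 - p) * (r' + s') ^ 2 * s) := by
      positivity
    refine this.trans (le_of_eq ?_)
    ring

theorem exists_abs_rpow_sub_rpow_le (q : ℝ) {a b : ℝ} (ha : 0 < a) : ∃ L, 0 ≤ L ∧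
    ∀ u ∈ Icc a b, ∀ v ∈ Icc a b, |u ^ q - v ^ q| ≤ L * |u - v| := by
  have hd : ∀ u ∈ Icc a b, HasDerivAt (fun u : ℝ => u ^ q) (q * u ^ (q - 1)) u := fun u hu =>
    Real.hasDerivAt_rpow_const (Or.inl (ha.trans_le hu.1).ne')
  have hc : ContinuousOn (fun u : ℝ => q * u ^ (q - 1)) (Icc a b) := fun u hu =>
    ((Real.continuousAt_rpow_const _ _ (Or.inl (ha.trans_le hu.1).ne')).const_mul
      q).continuousWithinAt
  obtain ⟨L, hL⟩ := isCompact_Icc.exists_bound_of_continuousOn hc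
  refine ⟨|L|, abs_nonneg _, fun u hu v hv => ?_⟩
  exact (convex_Icc a b).norm_image_sub_le_of_norm_hasDerivWithin_le
    (fun w hw => (hd w hw).hasDerivWithinAt) (fun w hw => (hL w hw).trans (le_abs_self L)) hv hu

theorem hasDerivAt_sqrt_sq_add_sq {ε : ℝ} (hε : 0 < ε) (x h θ : ℝ) :
    HasDerivAt (fun θ => √((x + θ * h) ^ 2 + ε ^ 2))
      ((x + θ * h) * h / √((x + θ * h) ^ 2 + ε ^ 2)) θ := by
  have h1 : HasDerivAt (fun θ => x + θ * h) h θ := by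
    simpa using ((hasDerivAt_id θ).mul_const h).const_add x
  refine (((h1.fun_pow 2).add_const (ε ^ 2)).sqrt (by positivity)).congr_deriv ?_
  have : √((x + θ * h) ^ 2 + ε ^ 2) ≠ 0 := (Real.sqrt_pos.2 (by positivity)).ne'
  field_simp
  push_cast
  ring

theorem hasDerivAt_deriv_sqrt_sq_add_sq {ε : ℝ} (hε : 0 < ε) (x h θ : ℝ) :
    HasDerivAt (fun θ => (x + θ * h) * h / √((x + θ * h) ^ 2 + ε ^ 2))
      ((h ^ 2 - ((x + θ * h) * h / √((x + θ * h) ^ 2 + ε ^ 2)) ^ 2) /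
        √((x + θ * h) ^ 2 + ε ^ 2)) θ := by
  have h1 : HasDerivAt (fun θ => (x + θ * h) * h) (h * h) θ := by
    simpa using (((hasDerivAt_id θ).mul_const h).const_add x).mul_const h
  have h0 : √((x + θ * h) ^ 2 + ε ^ 2) ≠ 0 := (Real.sqrt_pos.2 (by positivity)).ne'
  refine (h1.fun_div (hasDerivAt_sqrt_sq_add_sq hε x h θ) h0).congr_deriv ?_
  field_simp

/-- A smoothed multiple of Burkholder's function, `√(x² + ε²)` standing in for `|x|`. -/
noncomputable def burkholderFun (p ε x y : ℝ) : ℝ :=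
  (min 1 (p - 1) * √(y ^ 2 + ε ^ 2) - max 1 (p - 1) * √(x ^ 2 + ε ^ 2)) *
    (√(x ^ 2 + ε ^ 2) + √(y ^ 2 + ε ^ 2)) ^ (p - 1)

theorem continuous_burkholderFun {p : ℝ} (hp : 1 < p) (ε : ℝ) :
    Continuous fun z : ℝ × ℝ => burkholderFun p ε z.1 z.2 := by
  unfold burkholderFun
  have h : Continuous fun z : ℝ × ℝ =>
      (√(z.1 ^ 2 + ε ^ 2) + √(z.2 ^ 2 + ε ^ 2)) ^ (p - 1) :=
    Continuous.rpow_const (by fun_prop) fun z => Or.inr (by linarith)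
  fun_prop

set_option maxHeartbeats 1000000 in
theorem burkholderFun_taylor {p ε : ℝ} (hp : 1 < p) (hε : 0 < ε) (K : ℝ) :
    ∃ (φ ψ c : ℝ → ℝ → ℝ) (L : ℝ), 0 ≤ L ∧ (Continuous fun z : ℝ × ℝ => φ z.1 z.2) ∧
      (Continuous fun z : ℝ × ℝ => ψ z.1 z.2) ∧ (Continuous fun z : ℝ × ℝ => c z.1 z.2) ∧
      (∀ x y, 0 ≤ c x y) ∧ ∀ x y x' y', |x| ≤ K → |y| ≤ K → |x'| ≤ K → |y'| ≤ K →
        burkholderFun p ε x' y' ≤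
          burkholderFun p ε x y + φ x y * (x' - x) + ψ x y * (y' - y) -
          c x y * ((x' - x) ^ 2 - (y' - y) ^ 2) +
          L * ((|x' - x| + |y' - y|) * ((x' - x) ^ 2 + (y' - y) ^ 2)) := by
  set R : ℝ → ℝ := fun x => √(x ^ 2 + ε ^ 2) with hR
  have hRpos : ∀ x, 0 < R x := fun x => Real.sqrt_pos.2 (by positivity)
  have hRne : ∀ x, R x ≠ 0 := fun x => (hRpos x).ne'
  have hRc : Continuous R := by fun_prop
  have hRsq : ∀ x, R x ^ 2 = x ^ 2 + ε ^ 2 := fun x => Real.sq_sqrt (by positivity)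
  have hRε : ∀ x, ε ≤ R x := fun x => Real.le_sqrt_of_sq_le (by nlinarith)
  have hRK : ∀ x, |x| ≤ K → R x ≤ R K := fun x hx => Real.sqrt_le_sqrt (by
    have := sq_le_sq' (abs_le.1 hx).1 (abs_le.1 hx).2
    linarith)
  have hupos : ∀ x y, 0 < R x + R y := fun x y => add_pos (hRpos x) (hRpos y)
  have hpow : ∀ q : ℝ, Continuous fun z : ℝ × ℝ => (R z.1 + R z.2) ^ q := fun q =>
    Continuous.rpow_const (by fun_prop) fun z => Or.inl (hupos _ _).ne'
  obtain ⟨L, hL, hLip⟩ := exists_abs_rpow_sub_rpow_le (p - 2) (a := 2 * ε) (b := 2 * R K)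
    (by positivity)
  set a := min 1 (p - 1) with ha
  set b := max 1 (p - 1) with hb
  have hp0 : 0 < p := by linarith
  have hp1 : 0 < p - 1 := by linarith
  refine ⟨fun x y => -b * (x / R x) * (R x + R y) ^ (p - 1) +
      (a * R y - b * R x) * ((x / R x) * (p - 1) * (R x + R y) ^ (p - 2)),
    fun x y => a * (y / R y) * (R x + R y) ^ (p - 1) +
      (a * R y - b * R x) * ((y / R y) * (p - 1) * (R x + R y) ^ (p - 2)),
    fun x y => p * (p - 1) / 2 * (R x + R y) ^ (p - 2), p * (p - 1) * L / 2, by positivity,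
    ?_, ?_, ?_, fun x y => ?_, fun x y x' y' hx hy hx' hy' => ?_⟩
  · have h1 := hpow (p - 1)
    have h2 := hpow (p - 2)
    have h3 : Continuous fun z : ℝ × ℝ => z.1 / R z.1 :=
      continuous_fst.div (by fun_prop) fun z => hRne _
    fun_prop
  · have h1 := hpow (p - 1)
    have h2 := hpow (p - 2)
    have h3 : Continuous fun z : ℝ × ℝ => z.2 / R z.2 :=
      continuous_snd.div (by fun_prop) fun z => hRne _
    fun_prop
  · have h2 := hpow (p - 2)
    fun_prop
  · have := hupos x y
    positivity
  set h := x' - x with hh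
  set k := y' - y with hk
  set r : ℝ → ℝ := fun θ => R (x + θ * h) with hr
  set s : ℝ → ℝ := fun θ => R (y + θ * k) with hs
  set r' : ℝ → ℝ := fun θ => (x + θ * h) * h / r θ with hr'
  set s' : ℝ → ℝ := fun θ => (y + θ * k) * k / s θ with hs'
  set r'' : ℝ → ℝ := fun θ => (h ^ 2 - r' θ ^ 2) / r θ with hr''
  set s'' : ℝ → ℝ := fun θ => (k ^ 2 - s' θ ^ 2) / s θ with hs''
  have dr : ∀ θ, HasDerivAt r (r' θ) θ := hasDerivAt_sqrt_sq_add_sq hε x h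
  have ds : ∀ θ, HasDerivAt s (s' θ) θ := hasDerivAt_sqrt_sq_add_sq hε y k
  have dr' : ∀ θ, HasDerivAt r' (r'' θ) θ := hasDerivAt_deriv_sqrt_sq_add_sq hε x h
  have ds' : ∀ θ, HasDerivAt s' (s'' θ) θ := hasDerivAt_deriv_sqrt_sq_add_sq hε y k
  have hu : ∀ θ, 0 < r θ + s θ := fun θ => hupos _ _
  have dpow : ∀ q θ : ℝ, HasDerivAt (fun θ => (r θ + s θ) ^ q)
      ((r' θ + s' θ) * q * (r θ + s θ) ^ (q - 1)) θ := fun q θ =>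
    ((dr θ).fun_add (ds θ)).rpow_const (Or.inl (hu θ).ne')
  have dlin : ∀ θ, HasDerivAt (fun θ => a * s θ - b * r θ) (a * s' θ - b * r' θ) θ := fun θ =>
    ((ds θ).const_mul a).fun_sub ((dr θ).const_mul b)
  have dlin' : ∀ θ, HasDerivAt (fun θ => a * s' θ - b * r' θ) (a * s'' θ - b * r'' θ) θ :=
    fun θ => ((ds' θ).const_mul a).fun_sub ((dr' θ).const_mul b)
  set g : ℝ → ℝ := fun θ => (a * s θ - b * r θ) * (r θ + s θ) ^ (p - 1) with hg
  set g' : ℝ → ℝ := fun θ => (a * s' θ - b * r' θ) * (r θ + s θ) ^ (p - 1) +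
    (a * s θ - b * r θ) * ((r' θ + s' θ) * (p - 1) * (r θ + s θ) ^ (p - 2)) with hg'
  set g'' : ℝ → ℝ := fun θ => (r θ + s θ) ^ (p - 3) *
    ((a * s'' θ - b * r'' θ) * (r θ + s θ) ^ 2 +
      2 * (p - 1) * (a * s' θ - b * r' θ) * (r θ + s θ) * (r' θ + s' θ) +
      (a * s θ - b * r θ) * ((p - 1) * (p - 2) * (r' θ + s' θ) ^ 2 +
        (p - 1) * (r θ + s θ) * (r'' θ + s'' θ))) with hg''
  have e2 : ∀ θ, (r θ + s θ) ^ (p - 2) = (r θ + s θ) ^ (p - 3) * (r θ + s θ) := fun θ => by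
    rw [← Real.rpow_add_one (hu θ).ne']
    congr 1
    ring
  have e1 : ∀ θ, (r θ + s θ) ^ (p - 1) = (r θ + s θ) ^ (p - 3) * (r θ + s θ) ^ 2 := fun θ => by
    rw [← Real.rpow_add_natCast (hu θ).ne']
    congr 1
    push_cast
    ring
  have dg : ∀ θ, HasDerivAt g (g' θ) θ := fun θ => by
    refine ((dlin θ).fun_mul (dpow (p - 1) θ)).congr_deriv ?_
    simp only [hg']
    rw [show p - 1 - 1 = p - 2 by ring]
  have dg' : ∀ θ, HasDerivAt g' (g'' θ) θ := fun θ => by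
    refine (((dlin' θ).fun_mul (dpow (p - 1) θ)).fun_add ((dlin θ).fun_mul
      ((((dr' θ).fun_add (ds' θ)).mul_const (p - 1)).fun_mul (dpow (p - 2) θ)))).congr_deriv ?_
    rw [show p - 1 - 1 = p - 2 by ring, show p - 2 - 1 = p - 3 by ring, e1, e2]
    simp only [hg'']
    ring
  have hle'' : ∀ z l : ℝ, 0 ≤ (l ^ 2 - (z * l / R z) ^ 2) / R z := fun z l => by
    refine div_nonneg ?_ (hRpos z).le
    have : (z * l / R z) ^ 2 = z ^ 2 / R z ^ 2 * l ^ 2 := by ring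
    have hle : z ^ 2 / R z ^ 2 ≤ 1 :=
      div_le_one_of_le₀ (by rw [hRsq]; nlinarith) (by positivity)
    rw [this]
    nlinarith [sq_nonneg l]
  have hg''le : ∀ θ, g'' θ ≤ -(p * (p - 1) * (r θ + s θ) ^ (p - 2) * (h ^ 2 - k ^ 2)) := fun θ => by
    rw [e2]
    have hv := Real.rpow_nonneg (hu θ).le (p - 3)
    have hrs : ∀ l d t : ℝ, t ≠ 0 → l ^ 2 = t * ((l ^ 2 - d ^ 2) / t) + d ^ 2 := by
      intro l d t ht
      field_simp
      ring
    exact burkholder_second_deriv_le hp (hRpos _).le (hRpos _).le (hle'' (x + θ * h) h)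
      (hle'' (y + θ * k) k) hv (hrs h (r' θ) (r θ) (hRne _)) (hrs k (s' θ) (s θ) (hRne _))
  have hconv : ∀ z z' θ : ℝ, |z| ≤ K → |z'| ≤ K → θ ∈ Icc (0 : ℝ) 1 → |z + θ * (z' - z)| ≤ K := by
    intro z z' θ hz hz' hθ
    rw [abs_le] at *
    constructor <;> nlinarith [hθ.1, hθ.2]
  have hmem : ∀ θ ∈ Icc (0 : ℝ) 1, r θ + s θ ∈ Icc (2 * ε) (2 * R K) := fun θ hθ =>
    ⟨by linarith [hRε (x + θ * h), hRε (y + θ * k)], by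
      linarith [hRK _ (hconv x x' θ hx hx' hθ), hRK _ (hconv y y' θ hy hy' hθ)]⟩
  have hr0 : r 0 = R x := by simp [hr]
  have hs0 : s 0 = R y := by simp [hs]
  have hlip : ∀ θ ∈ Icc (0 : ℝ) 1,
      |(r θ + s θ) ^ (p - 2) - (r 0 + s 0) ^ (p - 2)| ≤ L * (|h| + |k|) := fun θ hθ => by
    refine (hLip _ (hmem θ hθ) _ (hmem 0 ⟨le_rfl, zero_le_one⟩)).trans ?_
    refine mul_le_mul_of_nonneg_left ?_ hL
    have h1 := abs_sqrt_sq_add_sq_sub_le hε (x + θ * h) x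
    have h2 := abs_sqrt_sq_add_sq_sub_le hε (y + θ * k) y
    rw [add_sub_cancel_left, abs_mul, abs_of_nonneg hθ.1] at h1 h2
    have h3 : r θ + s θ - (r 0 + s 0) = (R (x + θ * h) - R x) + (R (y + θ * k) - R y) := by
      rw [hr0, hs0]
      ring
    rw [h3]
    refine (abs_add_le _ _).trans (add_le_add (h1.trans ?_) (h2.trans ?_))
    · exact mul_le_of_le_one_left (abs_nonneg h) hθ.2
    · exact mul_le_of_le_one_left (abs_nonneg k) hθ.2
  have hB : ∀ θ ∈ Icc (0 : ℝ) 1, g'' θ ≤ -(p * (p - 1) * (r 0 + s 0) ^ (p - 2) * (h ^ 2 - k ^ 2)) +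
      p * (p - 1) * (L * (|h| + |k|)) * (h ^ 2 + k ^ 2) := fun θ hθ => by
    have h1 := hg''le θ
    have h2 := hlip θ hθ
    have h3 : |h ^ 2 - k ^ 2| ≤ h ^ 2 + k ^ 2 := by
      rw [abs_le]
      constructor <;> nlinarith [sq_nonneg h, sq_nonneg k]
    have h4 := mul_le_mul h2 h3 (abs_nonneg _) ((abs_nonneg _).trans h2)
    rw [← abs_mul] at h4
    have h5 := mul_le_mul_of_nonneg_left ((neg_le_abs _).trans h4) (mul_pos hp0 hp1).le
    linarith
  have hfin := le_add_add_half_of_deriv2_le dg dg' hB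
  have hg1 : g 1 = burkholderFun p ε x' y' := by
    simp [hg, hr, hs, hh, hk, burkholderFun, hR, ha, hb]
  have hg0 : g 0 = burkholderFun p ε x y := by
    simp [hg, hr, hs, burkholderFun, hR, ha, hb]
  rw [hg1, hg0] at hfin
  refine hfin.trans (le_of_eq ?_)
  simp only [hg', hr', hs', hr0, hs0]
  ring

theorem le_of_hasDerivAt_sign {f f' : ℝ → ℝ} {c z : ℝ} (hc : 0 < c) (hz : 0 < z)
    (hf : ∀ z, 0 < z → HasDerivAt f (f' z) z) (hneg : ∀ z, 0 < z → z ≤ c → f' z ≤ 0)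
    (hpos : ∀ z, c ≤ z → 0 ≤ f' z) : f c ≤ f z := by
  rcases le_total z c with h | h
  · have : AntitoneOn f (Ioc 0 c) := antitoneOn_of_deriv_nonpos (convex_Ioc 0 c)
      (fun z hz => (hf z hz.1).continuousAt.continuousWithinAt)
      (fun z hz => (hf z (interior_subset hz).1).differentiableAt.differentiableWithinAt)
      fun z hz => by
        have hz := interior_subset hz
        rw [(hf z hz.1).deriv]
        exact hneg z hz.1 hz.2
    exact this ⟨hz, h⟩ ⟨hc, le_rfl⟩ h
  · have : MonotoneOn f (Ici c) := monotoneOn_of_deriv_nonneg (convex_Ici c)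
      (fun z hz => (hf z (hc.trans_le hz)).continuousAt.continuousWithinAt)
      (fun z hz => (hf z (hc.trans_le
        (interior_subset hz))).differentiableAt.differentiableWithinAt)
      fun z hz => by
        have hz : c ≤ z := interior_subset hz
        rw [(hf z (hc.trans_le hz)).deriv]
        exact hpos z hz
    exact this self_mem_Ici h h

theorem burkholder_one_variable_of_two_le {p z : ℝ} (hp : 2 ≤ p) (hz : 0 < z) :
    1 - (p - 1) ^ p * z ^ p ≤
      (p - 1) ^ (p - 1) * p ^ (2 - p) * ((1 - (p - 1) * z) * (1 + z) ^ (p - 1)) := by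
  have hp0 : 0 < p := by linarith
  have hp1 : 0 < p - 1 := by linarith
  have hCp : (p - 1) ^ p = (p - 1) ^ (p - 1) * (p - 1) := by
    rw [← Real.rpow_add_one hp1.ne', sub_add_cancel]
  have hpp : p ^ (2 - p) * p ^ (p - 2) = 1 := by
    rw [← Real.rpow_add hp0]
    simp
  set f : ℝ → ℝ := fun z => (p - 1) ^ (p - 1) * p ^ (2 - p) *
    ((1 - (p - 1) * z) * (1 + z) ^ (p - 1)) - 1 + (p - 1) ^ p * z ^ p with hf
  have hd : ∀ z, 0 < z → HasDerivAt f
      (p * (p - 1) ^ p * z * (z ^ (p - 2) - ((1 + z) / p) ^ (p - 2))) z := fun z hz => by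
    have hz1 : 0 < 1 + z := by linarith
    have d1 : HasDerivAt (fun z : ℝ => (1 + z) ^ (p - 1))
        (1 * (p - 1) * (1 + z) ^ (p - 1 - 1)) z :=
      ((hasDerivAt_id z).const_add 1).rpow_const (Or.inl hz1.ne')
    have d2 : HasDerivAt (fun z : ℝ => 1 - (p - 1) * z) (-((p - 1) * 1)) z :=
      ((hasDerivAt_id z).const_mul (p - 1)).const_sub 1
    have d3 : HasDerivAt (fun z : ℝ => z ^ p) (p * z ^ (p - 1)) z :=
      Real.hasDerivAt_rpow_const (Or.inl hz.ne')
    refine ((((d2.fun_mul d1).const_mul ((p - 1) ^ (p - 1) * p ^ (2 - p))).sub_const 1).fun_add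
      (d3.const_mul ((p - 1) ^ p))).congr_deriv ?_
    have e1 : (1 + z) ^ (p - 1) = (1 + z) ^ (p - 2) * (1 + z) := by
      rw [← Real.rpow_add_one hz1.ne']
      ring_nf
    have e2 : z ^ (p - 1) = z ^ (p - 2) * z := by
      rw [← Real.rpow_add_one hz.ne']
      ring_nf
    have e3 : ((1 + z) / p) ^ (p - 2) = (1 + z) ^ (p - 2) * p ^ (2 - p) := by
      rw [Real.div_rpow hz1.le hp0.le, div_eq_iff (by positivity), mul_assoc, hpp, mul_one]
    rw [show p - 1 - 1 = p - 2 by ring, e1, e2, e3, hCp]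
    ring
  have hmin := le_of_hasDerivAt_sign (c := (p - 1)⁻¹) (z := z) (by positivity) hz hd
    (fun z hz hzc => ?_) fun z hzc => ?_
  · have h0 : f (p - 1)⁻¹ = 0 := by
      simp only [hf]
      rw [Real.inv_rpow hp1.le, mul_inv_cancel₀ hp1.ne', mul_inv_cancel₀ (by positivity)]
      ring
    rw [h0] at hmin
    simp only [hf] at hmin
    linarith
  · have h1 : z ≤ (1 + z) / p := by
      rw [le_inv_comm₀ hz hp1, ← one_div, le_div_iff₀ hz] at hzc
      rw [le_div_iff₀ hp0]
      linarith
    exact mul_nonpos_of_nonneg_of_nonpos (by positivity)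
      (sub_nonpos.2 (Real.rpow_le_rpow hz.le h1 (by linarith)))
  · have hz : 0 < z := (inv_pos.2 hp1).trans_le hzc
    have h1 : (1 + z) / p ≤ z := by
      rw [inv_le_comm₀ hp1 hz, ← one_div, div_le_iff₀ hz] at hzc
      rw [div_le_iff₀ hp0]
      linarith
    exact mul_nonneg (by positivity)
      (sub_nonneg.2 (Real.rpow_le_rpow (by positivity) h1 (by linarith)))

theorem burkholder_one_variable_of_le_two {p z : ℝ} (hp : 1 < p) (hp2 : p ≤ 2) (hz : 0 < z) :
    z ^ p - (p - 1)⁻¹ ^ p ≤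
      p ^ (2 - p) / (p - 1) * (((p - 1) * z - 1) * (1 + z) ^ (p - 1)) := by
  have hp0 : 0 < p := by linarith
  have hp1 : 0 < p - 1 := by linarith
  have hpp : p ^ (2 - p) * p ^ (p - 2) = 1 := by
    rw [← Real.rpow_add hp0]
    simp
  set f : ℝ → ℝ := fun z => p ^ (2 - p) / (p - 1) * (((p - 1) * z - 1) * (1 + z) ^ (p - 1)) +
    (p - 1)⁻¹ ^ p - z ^ p with hf
  have hd : ∀ z, 0 < z → HasDerivAt f
      (p * z * (((1 + z) / p) ^ (p - 2) - z ^ (p - 2))) z := fun z hz => by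
    have hz1 : 0 < 1 + z := by linarith
    have d1 : HasDerivAt (fun z : ℝ => (1 + z) ^ (p - 1))
        (1 * (p - 1) * (1 + z) ^ (p - 1 - 1)) z :=
      ((hasDerivAt_id z).const_add 1).rpow_const (Or.inl hz1.ne')
    have d2 : HasDerivAt (fun z : ℝ => (p - 1) * z - 1) ((p - 1) * 1) z :=
      ((hasDerivAt_id z).const_mul (p - 1)).sub_const 1
    have d3 : HasDerivAt (fun z : ℝ => z ^ p) (p * z ^ (p - 1)) z :=
      Real.hasDerivAt_rpow_const (Or.inl hz.ne')
    refine ((((d2.fun_mul d1).const_mul (p ^ (2 - p) / (p - 1))).add_const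
      ((p - 1)⁻¹ ^ p)).fun_sub d3).congr_deriv ?_
    have e1 : (1 + z) ^ (p - 1) = (1 + z) ^ (p - 2) * (1 + z) := by
      rw [← Real.rpow_add_one hz1.ne']
      ring_nf
    have e2 : z ^ (p - 1) = z ^ (p - 2) * z := by
      rw [← Real.rpow_add_one hz.ne']
      ring_nf
    have e3 : ((1 + z) / p) ^ (p - 2) = (1 + z) ^ (p - 2) * p ^ (2 - p) := by
      rw [Real.div_rpow hz1.le hp0.le, div_eq_iff (by positivity), mul_assoc, hpp, mul_one]
    rw [show p - 1 - 1 = p - 2 by ring, e1, e2, e3]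
    field_simp
    ring
  have hmin := le_of_hasDerivAt_sign (c := (p - 1)⁻¹) (z := z) (by positivity) hz hd
    (fun z hz hzc => ?_) fun z hzc => ?_
  · have h0 : f (p - 1)⁻¹ = 0 := by
      simp only [hf]
      rw [mul_inv_cancel₀ hp1.ne']
      ring
    rw [h0] at hmin
    simp only [hf] at hmin
    linarith
  · have h1 : z ≤ (1 + z) / p := by
      rw [le_inv_comm₀ hz hp1, ← one_div, le_div_iff₀ hz] at hzc
      rw [le_div_iff₀ hp0]
      linarith
    exact mul_nonpos_of_nonneg_of_nonpos (by positivity)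
      (sub_nonpos.2 (Real.rpow_le_rpow_of_nonpos hz h1 (by linarith)))
  · have hz : 0 < z := (inv_pos.2 hp1).trans_le hzc
    have h1 : (1 + z) / p ≤ z := by
      rw [inv_le_comm₀ hp1 hz, ← one_div, div_le_iff₀ hz] at hzc
      rw [div_le_iff₀ hp0]
      linarith
    exact mul_nonneg (by positivity)
      (sub_nonneg.2 (Real.rpow_le_rpow_of_nonpos (by positivity) h1 (by linarith)))

theorem exists_rpow_sub_rpow_le_burkholder {p : ℝ} (hp : 1 < p) : ∃ α, 0 ≤ α ∧
    ∀ r s, 0 < r → 0 < s → s ^ p - (max p (p / (p - 1)) - 1) ^ p * r ^ p ≤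
      α * ((min 1 (p - 1) * s - max 1 (p - 1) * r) * (r + s) ^ (p - 1)) := by
  have hp0 : 0 < p := by linarith
  have hp1 : 0 < p - 1 := by linarith
  rcases le_total 2 p with h2 | h2
  · refine ⟨(p - 1) ^ (p - 1) * p ^ (2 - p), by positivity, fun r s hr hs => ?_⟩
    rw [min_eq_left (by linarith), max_eq_right (by linarith : 1 ≤ p - 1),
      max_eq_left (by rw [div_le_iff₀ hp1]; nlinarith)]
    have h := mul_le_mul_of_nonneg_left (burkholder_one_variable_of_two_le h2 (div_pos hr hs))
      (Real.rpow_nonneg hs.le p)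
    have e1 : s ^ p = s ^ (p - 1) * s := by rw [← Real.rpow_add_one hs.ne', sub_add_cancel]
    rw [show 1 + r / s = (r + s) / s by field_simp; ring, Real.div_rpow hr.le hs.le,
      Real.div_rpow (by positivity) hs.le] at h
    have hs1 : 0 < s ^ (p - 1) := by positivity
    have hs2 : 0 < s ^ p := by positivity
    refine (le_of_eq ?_).trans (h.trans (le_of_eq ?_))
    · field_simp
    · rw [e1]
      generalize s ^ (p - 1) = A at *
      generalize (p - 1) ^ (p - 1) * p ^ (2 - p) = B
      generalize (r + s) ^ (p - 1) = D
      field_simp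
  · refine ⟨p ^ (2 - p) / (p - 1), by positivity, fun r s hr hs => ?_⟩
    rw [min_eq_right (by linarith), max_eq_left (by linarith : p - 1 ≤ 1),
      max_eq_right (by rw [le_div_iff₀ hp1]; nlinarith),
      show p / (p - 1) - 1 = (p - 1)⁻¹ by field_simp; ring]
    have h := mul_le_mul_of_nonneg_left
      (burkholder_one_variable_of_le_two hp h2 (div_pos hs hr)) (Real.rpow_nonneg hr.le p)
    have e1 : r ^ p = r ^ (p - 1) * r := by rw [← Real.rpow_add_one hr.ne', sub_add_cancel]
    rw [show 1 + s / r = (r + s) / r by field_simp, Real.div_rpow hs.le hr.le,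
      Real.div_rpow (by positivity) hr.le] at h
    have hs1 : 0 < r ^ (p - 1) := by positivity
    have hs2 : 0 < r ^ p := by positivity
    refine (le_of_eq ?_).trans (h.trans (le_of_eq ?_))
    · field_simp
    · rw [e1]
      generalize r ^ (p - 1) = A at *
      generalize p ^ (2 - p) / (p - 1) = B
      generalize (r + s) ^ (p - 1) = D
      field_simp

theorem integral_rpow_le_of_abs_le {Ω : Type*} {m : MeasurableSpace Ω} {P : Measure Ω}
    [IsProbabilityMeasure P] {ℱ : Filtration ℝ≥0 m} {X Y QX QY : ℝ≥0 → Ω → ℝ}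
    (hX : Martingale X ℱ P) (hY : Martingale Y ℱ P)
    (hXc : ∀ ω, Continuous fun t => X t ω) (hYc : ∀ ω, Continuous fun t => Y t ω)
    (hY0 : ∀ ω, Y 0 ω = 0)
    (hQX : Martingale (fun t ω => X t ω ^ 2 - QX t ω) ℱ P)
    (hQY : Martingale (fun t ω => Y t ω ^ 2 - QY t ω) ℱ P)
    (hsub : ∀ ω, Monotone fun t => QX t ω - QY t ω)
    {K : ℝ} (hXK : ∀ t ω, |X t ω| ≤ K) (hYK : ∀ t ω, |Y t ω| ≤ K)
    {p : ℝ} (hp : 1 < p) (T : ℝ≥0) :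
    ∫ ω, |Y T ω| ^ p ∂P ≤ (max p (p / (p - 1)) - 1) ^ p * ∫ ω, |X T ω| ^ p ∂P := by
  have hp0 : 0 < p := by linarith
  have hXm : ∀ t, Measurable (X t) := fun t => ((hX.1 t).mono (ℱ.le t)).measurable
  have hYm : ∀ t, Measurable (Y t) := fun t => ((hY.1 t).mono (ℱ.le t)).measurable
  have hbd : ∀ {F : ℝ → ℝ → ℝ}, (Continuous fun z : ℝ × ℝ => F z.1 z.2) → ∀ t,
      Integrable (fun ω => F (X t ω) (Y t ω)) P := fun {F} hF t => by
    obtain ⟨C, hC⟩ := exists_abs_le_of_continuous hF K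
    exact integrable_of_abs_le (hF.measurable.comp ((hXm t).prodMk (hYm t)))
      fun ω => hC _ _ (hXK t ω) (hYK t ω)
  set C := max p (p / (p - 1)) - 1 with hC
  obtain ⟨α, hα, hαle⟩ := exists_rpow_sub_rpow_le_burkholder hp
  have hpow : ∀ ε : ℝ, Continuous fun x : ℝ => √(x ^ 2 + ε ^ 2) ^ p := fun ε =>
    Continuous.rpow_const (by fun_prop) fun _ => Or.inr hp0.le
  have habs : Continuous fun x : ℝ => |x| ^ p :=
    Continuous.rpow_const (by fun_prop) fun _ => Or.inr hp0.le
  have hε : ∀ ε : ℝ, 0 < ε → ∫ ω, |Y T ω| ^ p ∂P ≤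
      C ^ p * ∫ ω, √(X T ω ^ 2 + ε ^ 2) ^ p ∂P := fun ε hε => by
    obtain ⟨φ, ψ, c, L, hL, hφ, hψ, hc, hc0, htaylor⟩ := burkholderFun_taylor hp hε K
    have hdec := integral_comp_le_of_taylor hX hY hXc hYc hQX hQY hsub hXK hYK hL
      (continuous_burkholderFun hp ε) hφ hψ hc hc0 htaylor T
    have hstart : ∫ ω, burkholderFun p ε (X 0 ω) (Y 0 ω) ∂P ≤ 0 := by
      refine integral_nonpos fun ω => ?_
      have h1 : ε ≤ √(X 0 ω ^ 2 + ε ^ 2) := Real.le_sqrt_of_sq_le (by nlinarith)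
      simp only [burkholderFun, hY0, ne_eq, OfNat.ofNat_ne_zero, not_false_eq_true, zero_pow,
        zero_add, Real.sqrt_sq hε.le, Pi.zero_apply]
      refine mul_nonpos_of_nonpos_of_nonneg (sub_nonpos.2 ?_) (by positivity)
      exact mul_le_mul min_le_max h1 hε.le (by positivity)
    have hsqrt : ∀ x : ℝ, 0 < √(x ^ 2 + ε ^ 2) := fun x => Real.sqrt_pos.2 (by positivity)
    have hint : ∫ ω, (√(Y T ω ^ 2 + ε ^ 2) ^ p - C ^ p * √(X T ω ^ 2 + ε ^ 2) ^ p) ∂P ≤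
        ∫ ω, α * burkholderFun p ε (X T ω) (Y T ω) ∂P := by
      have h1 : Continuous fun z : ℝ × ℝ => √(z.2 ^ 2 + ε ^ 2) ^ p -
          C ^ p * √(z.1 ^ 2 + ε ^ 2) ^ p :=
        ((hpow ε).comp continuous_snd).sub (continuous_const.mul ((hpow ε).comp continuous_fst))
      exact integral_mono
        (hbd (F := fun x y => √(y ^ 2 + ε ^ 2) ^ p - C ^ p * √(x ^ 2 + ε ^ 2) ^ p) h1 T)
        ((hbd (continuous_burkholderFun hp ε) T).const_mul α)
        fun ω => hαle _ _ (hsqrt _) (hsqrt _)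
    have iY := hbd (F := fun _ y => √(y ^ 2 + ε ^ 2) ^ p) ((hpow ε).comp continuous_snd) T
    have iX := hbd (F := fun x _ => √(x ^ 2 + ε ^ 2) ^ p) ((hpow ε).comp continuous_fst) T
    have hle : ∫ ω, |Y T ω| ^ p ∂P ≤ ∫ ω, √(Y T ω ^ 2 + ε ^ 2) ^ p ∂P :=
      integral_mono (hbd (F := fun _ y => |y| ^ p) (habs.comp continuous_snd) T) iY fun ω =>
        Real.rpow_le_rpow (abs_nonneg _) (Real.abs_le_sqrt (by nlinarith)) hp0.le
    rw [integral_sub iY (iX.const_mul _), integral_const_mul, integral_const_mul] at hint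
    have := mul_nonpos_of_nonneg_of_nonpos hα (hdec.trans hstart)
    linarith
  have hlim : Tendsto (fun n : ℕ => C ^ p * ∫ ω, √(X T ω ^ 2 + (1 / ((n : ℝ) + 1)) ^ 2) ^ p ∂P)
      atTop (𝓝 (C ^ p * ∫ ω, |X T ω| ^ p ∂P)) := by
    refine Tendsto.const_mul _ (tendsto_integral_of_dominated_convergence
      (fun ω => √(X T ω ^ 2 + 1 ^ 2) ^ p) (fun n => ?_) ?_ (fun n => ?_) ?_)
    · exact ((hpow _).measurable.comp (hXm T)).aestronglyMeasurable
    · exact hbd (F := fun x _ => √(x ^ 2 + 1 ^ 2) ^ p) ((hpow 1).comp continuous_fst) T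
    · refine ae_of_all _ fun ω => ?_
      rw [Real.norm_of_nonneg (by positivity)]
      have : 1 / ((n : ℝ) + 1) ≤ 1 := div_le_one_of_le₀ (by simp) (by positivity)
      gcongr
    · refine ae_of_all _ fun ω => ?_
      have h1 : Continuous fun ε : ℝ => √(X T ω ^ 2 + ε ^ 2) ^ p :=
        Continuous.rpow_const (by fun_prop) fun _ => Or.inr hp0.le
      have h2 := (h1.tendsto 0).comp (tendsto_one_div_add_atTop_nhds_zero_nat (𝕜 := ℝ))
      simpa [Real.sqrt_sq_eq_abs, Function.comp_def] using h2
  exact ge_of_tendsto' hlim fun n => hε _ (by positivity)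

theorem eLpNorm_le_of_abs_le {Ω : Type*} {m : MeasurableSpace Ω} {P : Measure Ω}
    [IsProbabilityMeasure P] {ℱ : Filtration ℝ≥0 m} {X Y QX QY : ℝ≥0 → Ω → ℝ}
    (hX : Martingale X ℱ P) (hY : Martingale Y ℱ P)
    (hXc : ∀ ω, Continuous fun t => X t ω) (hYc : ∀ ω, Continuous fun t => Y t ω)
    (hY0 : ∀ ω, Y 0 ω = 0)
    (hQX : Martingale (fun t ω => X t ω ^ 2 - QX t ω) ℱ P)
    (hQY : Martingale (fun t ω => Y t ω ^ 2 - QY t ω) ℱ P)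
    (hsub : ∀ ω, Monotone fun t => QX t ω - QY t ω)
    {K : ℝ} (hXK : ∀ t ω, |X t ω| ≤ K) (hYK : ∀ t ω, |Y t ω| ≤ K)
    {p : ℝ} (hp : 1 < p) (T : ℝ≥0) :
    eLpNorm (Y T) (ENNReal.ofReal p) P ≤
      ENNReal.ofReal (max p (p / (p - 1)) - 1) * eLpNorm (X T) (ENNReal.ofReal p) P := by
  have hp0 : 0 < p := by linarith
  have hXm : Measurable (X T) := ((hX.1 T).mono (ℱ.le T)).measurable
  have hYm : Measurable (Y T) := ((hY.1 T).mono (ℱ.le T)).measurable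
  have hC : 0 ≤ max p (p / (p - 1)) - 1 := by linarith [le_max_left p (p / (p - 1))]
  have hp0' : ENNReal.ofReal p ≠ 0 := by simpa using hp0
  have mX : MemLp (X T) (ENNReal.ofReal p) P :=
    MemLp.of_bound hXm.aestronglyMeasurable K (ae_of_all _ (hXK T))
  have mY : MemLp (Y T) (ENNReal.ofReal p) P :=
    MemLp.of_bound hYm.aestronglyMeasurable K (ae_of_all _ (hYK T))
  rw [mX.eLpNorm_eq_integral_rpow_norm hp0' ENNReal.ofReal_ne_top,
    mY.eLpNorm_eq_integral_rpow_norm hp0' ENNReal.ofReal_ne_top, ENNReal.toReal_ofReal hp0.le,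
    ← ENNReal.ofReal_mul hC]
  refine ENNReal.ofReal_le_ofReal ?_
  simp only [Real.norm_eq_abs]
  have hI : 0 ≤ ∫ ω, |X T ω| ^ p ∂P := integral_nonneg fun ω => by positivity
  refine (Real.rpow_le_rpow (integral_nonneg fun ω => by positivity)
    (integral_rpow_le_of_abs_le hX hY hXc hYc hY0 hQX hQY hsub hXK hYK hp T)
    (inv_nonneg.2 hp0.le)).trans (le_of_eq ?_)
  rw [Real.mul_rpow (by positivity) hI, Real.rpow_rpow_inv hC hp0.ne']

theorem eLpNorm_le_of_differentially_subordinate {Ω : Type*} {m : MeasurableSpace Ω}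
    {P : Measure Ω} [IsProbabilityMeasure P] {ℱ : Filtration ℝ≥0 m} {X Y QX QY : ℝ≥0 → Ω → ℝ}
    (hX : Martingale X ℱ P) (hY : Martingale Y ℱ P)
    (hXc : ∀ ω, Continuous fun t => X t ω) (hYc : ∀ ω, Continuous fun t => Y t ω)
    (hY0 : ∀ ω, Y 0 ω = 0)
    (hQXc : ∀ ω, Continuous fun t => QX t ω) (hQYc : ∀ ω, Continuous fun t => QY t ω)
    (hQX : Martingale (fun t ω => X t ω ^ 2 - QX t ω) ℱ P)
    (hQY : Martingale (fun t ω => Y t ω ^ 2 - QY t ω) ℱ P)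
    (hsub : ∀ ω, Monotone fun t => QX t ω - QY t ω)
    {p : ℝ} (hp : 1 < p) (T : ℝ≥0) :
    eLpNorm (Y T) (ENNReal.ofReal p) P ≤
      ENNReal.ofReal (max p (p / (p - 1)) - 1) * eLpNorm (X T) (ENNReal.ofReal p) P := by
  have hD : StronglyAdapted ℱ fun t ω => |X t ω| + |Y t ω| := fun t =>
    (hX.1 t).norm.add (hY.1 t).norm
  have hDc : ∀ ω, Continuous fun t => |X t ω| + |Y t ω| := fun ω => (hXc ω).abs.add (hYc ω).abs
  choose ρ hρ hρle hρT using fun n : ℕ => exists_stoppingTime_le_of_continuous hD hDc (n : ℝ) T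
  set A : ℕ → Set Ω := fun n => {ω | |X 0 ω| + |Y 0 ω| ≤ n} with hA
  have hAm : ∀ n, MeasurableSet[ℱ 0] (A n) := fun n =>
    measurableSet_le (hD 0).measurable measurable_const
  set trunc : (ℝ≥0 → Ω → ℝ) → ℕ → ℝ≥0 → Ω → ℝ := fun Z n t =>
    (A n).indicator fun ω => Z (min (ρ n ω) t) ω
  have trunc_of_mem : ∀ {n ω}, ω ∈ A n → ∀ Z t, trunc Z n t ω = Z (min (ρ n ω) t) ω :=
    fun hω Z t => indicator_of_mem hω _
  have trunc_of_notMem : ∀ {n ω}, ω ∉ A n → ∀ Z t, trunc Z n t ω = 0 :=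
    fun hω Z t => indicator_of_notMem hω _
  have hmart : ∀ {Z}, Martingale Z ℱ P → (∀ ω, Continuous fun t => Z t ω) → ∀ n,
      Martingale (trunc Z n) ℱ P := fun hZ hZc n => martingale_indicator_stopped hZ hZc (hρ n) (hAm n)
  have hcont : ∀ {Z : ℝ≥0 → Ω → ℝ}, (∀ ω, Continuous fun t => Z t ω) → ∀ n ω,
      Continuous fun t => trunc Z n t ω := fun {Z} hZc n ω => by
    by_cases hω : ω ∈ A n
    · simp only [trunc_of_mem hω]
      exact (hZc ω).comp (continuous_const.min continuous_id)
    · simp only [trunc_of_notMem hω]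
      exact continuous_const
  have hsq : ∀ {Z Q : ℝ≥0 → Ω → ℝ}, Martingale (fun t ω => Z t ω ^ 2 - Q t ω) ℱ P →
      (∀ ω, Continuous fun t => Z t ω) → (∀ ω, Continuous fun t => Q t ω) → ∀ n,
      Martingale (fun t ω => trunc Z n t ω ^ 2 - trunc Q n t ω) ℱ P :=
    fun {Z Q} hZ hZc hQc n => by
      convert hmart hZ (fun ω => ((hZc ω).pow 2).sub (hQc ω)) n using 3 with t ω
      by_cases hω : ω ∈ A n
      · simp only [trunc_of_mem hω]
      · simp only [trunc_of_notMem hω]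
        simp
  have hbdd : ∀ n t ω, |trunc X n t ω| ≤ n ∧ |trunc Y n t ω| ≤ n := fun n t ω => by
    by_cases hω : ω ∈ A n
    · have h := hρle n ω hω _ (min_le_left (ρ n ω) t)
      simp only [trunc_of_mem hω]
      constructor <;> linarith [abs_nonneg (X (min (ρ n ω) t) ω), abs_nonneg (Y (min (ρ n ω) t) ω)]
    · simp [trunc_of_notMem hω]
  have hstep : ∀ n, eLpNorm (trunc Y n T) (ENNReal.ofReal p) P ≤
      ENNReal.ofReal (max p (p / (p - 1)) - 1) * eLpNorm (X T) (ENNReal.ofReal p) P := fun n => by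
    refine (eLpNorm_le_of_abs_le (hmart hX hXc n) (hmart hY hYc n) (hcont hXc n) (hcont hYc n)
      (fun ω => ?_) (hsq hQX hXc hQXc n) (hsq hQY hYc hQYc n) (fun ω => ?_)
      (fun t ω => (hbdd n t ω).1) (fun t ω => (hbdd n t ω).2) hp T).trans ?_
    · by_cases hω : ω ∈ A n
      · rw [trunc_of_mem hω, min_eq_right (zero_le (a := ρ n ω)), hY0]
      · exact trunc_of_notMem hω _ _
    · by_cases hω : ω ∈ A n
      · simp only [trunc_of_mem hω]
        exact (hsub ω).comp fun s t hst => min_le_min_left _ hst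
      · simp only [trunc_of_notMem hω]
        exact monotone_const
    · refine mul_le_mul_right ?_ _
      refine (eLpNorm_indicator_le _).trans ?_
      have hmin : IsStoppingTime ℱ fun ω => ((min (ρ n ω) T : ℝ≥0) : WithTop ℝ≥0) := by
        simpa using (hρ n).min_const T
      exact (optional_stopping hX hXc hmin fun ω => min_le_right _ _).2.2 _
        (by simpa using ENNReal.ofReal_le_ofReal hp.le)
  have hYm : ∀ n, AEStronglyMeasurable (trunc Y n T) P := fun n =>
    (((hmart hY hYc n).1 T).mono (ℱ.le T)).aestronglyMeasurable
  have hlim : ∀ ω, Tendsto (fun n => trunc Y n T ω) atTop (𝓝 (Y T ω)) := fun ω => by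
    obtain ⟨B, hB⟩ := (isCompact_Icc (a := (0 : ℝ≥0)) (b := T)).exists_bound_of_continuousOn
      (hDc ω).continuousOn
    refine tendsto_const_nhds.congr' ?_
    filter_upwards [eventually_gt_atTop ⌈B⌉₊] with n hn
    have hBn : B < n := (Nat.le_ceil B).trans_lt (by exact_mod_cast hn)
    have hlt : ∀ s ≤ T, |X s ω| + |Y s ω| < n := fun s hs =>
      ((le_abs_self _).trans (hB s ⟨zero_le, hs⟩)).trans_lt hBn
    rw [trunc_of_mem (show ω ∈ A n from (hlt 0 zero_le).le), hρT n ω hlt, min_self]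
  refine (Lp.eLpNorm_lim_le_liminf_eLpNorm hYm (Y T) (ae_of_all _ hlim)).trans ?_
  exact liminf_le_of_le (by isBoundedDefault) fun b hb => (hb.exists.choose_spec).trans (hstep _)

/-- Sharp differential subordination inequality (Burkholder–Davis–Wang) for continuous
martingales: if `Y` is a continuous martingale with `Y_0 = 0` differentially subordinate
to the continuous martingale `X` (i.e. `[X,X]_t - [Y,Y]_t` is nonnegative and
nondecreasing, the quadratic variations `QX`, `QY` being characterized by starting at
`0`, being continuous nondecreasing and making `X² - QX`, `Y² - QY` martingales), then
for `1 < p < ∞`, `sup_t ‖Y_t‖_p ≤ (p*-1) sup_t ‖X_t‖_p` with `p* = max{p, p/(p-1)}`. -/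
theorem stmt7 {Ω : Type} {m : MeasurableSpace Ω} (P : Measure Ω) [IsProbabilityMeasure P]
    (ℱ : MeasureTheory.Filtration ℝ≥0 m) (X Y QX QY : ℝ≥0 → Ω → ℝ)
    (hX : Martingale X ℱ P) (hY : Martingale Y ℱ P)
    (hXc : ∀ ω, Continuous fun t => X t ω) (hYc : ∀ ω, Continuous fun t => Y t ω)
    (hY0 : ∀ ω, Y 0 ω = 0)
    (hQX0 : ∀ ω, QX 0 ω = 0) (hQY0 : ∀ ω, QY 0 ω = 0)
    (hQXmono : ∀ ω, Monotone fun t => QX t ω) (hQYmono : ∀ ω, Monotone fun t => QY t ω)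
    (hQXc : ∀ ω, Continuous fun t => QX t ω) (hQYc : ∀ ω, Continuous fun t => QY t ω)
    (hQXmart : Martingale (fun t ω => X t ω ^ 2 - QX t ω) ℱ P)
    (hQYmart : Martingale (fun t ω => Y t ω ^ 2 - QY t ω) ℱ P)
    (hsub : ∀ ω, Monotone fun t => QX t ω - QY t ω)
    (hsubnonneg : ∀ t ω, 0 ≤ QX t ω - QY t ω)
    (p : ℝ) (hp : 1 < p) :
    ⨆ t, eLpNorm (Y t) (ENNReal.ofReal p) P ≤
      ENNReal.ofReal (max p (p / (p - 1)) - 1) *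
        ⨆ t, eLpNorm (X t) (ENNReal.ofReal p) P := by
  refine iSup_le fun T => (eLpNorm_le_of_differentially_subordinate hX hY hXc hYc hY0 hQXc hQYc
    hQXmart hQYmart hsub hp T).trans ?_
  exact mul_le_mul_right (le_iSup (fun t => eLpNorm (X t) (ENNReal.ofReal p) P) T) _
end

section
/- Let f = (f_n)_{n≥0} be a discrete-time martingale with difference sequence df_k, and let v = (v_k)_{k≥0} be a predictable sequence with values in [-1,1]. Let g_n = Σ_{k=0}^n v_k df_k be the martingale transform. Then for 1 < p < ∞, sup_n ||g_n||_p ≤ (p*-1) sup_n ||f_n||_p with p* = max{p, p/(p-1)}. -/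
open MeasureTheory Filter Set
open scoped NNReal ENNReal

theorem rpow_tangent_le {q s S : ℝ} (hq : 1 ≤ q) (hs : 0 < s) (hS : 0 ≤ S) :
    q * s ^ (q - 1) * (S - s) ≤ S ^ q - s ^ q := by
  have h := one_add_mul_self_le_rpow_one_add (s := S / s - 1)
    (by linarith [div_nonneg hS hs.le]) hq
  rw [add_sub_cancel, Real.div_rpow hS hs.le, le_div_iff₀ (by positivity)] at h
  rw [Real.rpow_sub_one hs.ne']
  have e : (1 + q * (S / s - 1)) * s ^ q = s ^ q + q * (s ^ q / s) * (S - s) := by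
    field_simp
  linarith

theorem le_rpow_tangent {q s S : ℝ} (hq0 : 0 ≤ q) (hq : q ≤ 1) (hs : 0 < s) (hS : 0 ≤ S) :
    S ^ q - s ^ q ≤ q * s ^ (q - 1) * (S - s) := by
  have h := rpow_one_add_le_one_add_mul_self (s := S / s - 1)
    (by linarith [div_nonneg hS hs.le]) hq0 hq
  rw [add_sub_cancel, Real.div_rpow hS hs.le, div_le_iff₀ (by positivity)] at h
  rw [Real.rpow_sub_one hs.ne']
  have e : (1 + q * (S / s - 1)) * s ^ q = s ^ q + q * (s ^ q / s) * (S - s) := by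
    field_simp
  linarith

theorem monotoneOn_Ici_of_hasDerivAt {f f' : ℝ → ℝ} {a : ℝ} (hf : ContinuousOn f (Ici a))
    (hd : ∀ x, a < x → HasDerivAt f (f' x) x) (h : ∀ x, a < x → 0 ≤ f' x) :
    MonotoneOn f (Ici a) := by
  refine monotoneOn_of_hasDerivWithinAt_nonneg (convex_Ici a) hf (f' := f') ?_ ?_ <;>
    rw [interior_Ici]
  · exact fun x hx => (hd x hx).hasDerivWithinAt
  · exact h

theorem hasDerivAt_trapezoid {q s S : ℝ} (hS : 0 < S) :
    HasDerivAt (fun S => (q + 1) / 2 * ((S - s) * (S ^ q + s ^ q)) - S ^ (q + 1))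
      ((q + 1) / 2 * (s ^ q - S ^ q - q * S ^ (q - 1) * (s - S))) S := by
  have h1 := (((hasDerivAt_id S).sub_const s).mul
    ((Real.hasDerivAt_rpow_const (p := q) (Or.inl hS.ne')).add_const (s ^ q))).const_mul
      ((q + 1) / 2)
  have h2 := h1.sub (Real.hasDerivAt_rpow_const (p := q + 1) (Or.inl hS.ne'))
  refine h2.congr_deriv ?_
  simp only [add_sub_cancel_right, id]
  ring

theorem hasDerivAt_taylor {q s S : ℝ} (hS : 0 < S) :
    HasDerivAt (fun S => S ^ (q + 1) - (q + 1) * s ^ q * (S - s)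
        - (q + 1) / 2 * (q * s ^ (q - 1)) * (S - s) ^ 2)
      ((q + 1) * (S ^ q - s ^ q - q * s ^ (q - 1) * (S - s))) S := by
  have h0 := (hasDerivAt_id S).sub_const s
  have h := ((Real.hasDerivAt_rpow_const (p := q + 1) (Or.inl hS.ne')).sub
    (h0.const_mul ((q + 1) * s ^ q))).sub ((h0.pow 2).const_mul ((q + 1) / 2 * (q * s ^ (q - 1))))
  refine h.congr_deriv ?_
  simp only [add_sub_cancel_right, id]
  push_cast
  ring

theorem continuous_trapezoid {q s : ℝ} (hq : 0 ≤ q) :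
    Continuous (fun S : ℝ => (q + 1) / 2 * ((S - s) * (S ^ q + s ^ q)) - S ^ (q + 1)) := by
  have h1 := Real.continuous_rpow_const hq
  have h2 := Real.continuous_rpow_const (q := q + 1) (by linarith)
  fun_prop

theorem continuous_taylor {q s : ℝ} (hq : 0 ≤ q) :
    Continuous (fun S : ℝ => S ^ (q + 1) - (q + 1) * s ^ q * (S - s)
        - (q + 1) / 2 * (q * s ^ (q - 1)) * (S - s) ^ 2) := by
  have h2 := Real.continuous_rpow_const (q := q + 1) (by linarith)
  fun_prop

theorem rpow_sub_le_trapezoid {q s S : ℝ} (hq : 1 ≤ q) (hs : 0 ≤ s) (hS : s ≤ S) :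
    S ^ (q + 1) - s ^ (q + 1) ≤ (q + 1) / 2 * ((S - s) * (S ^ q + s ^ q)) := by
  have h := monotoneOn_Ici_of_hasDerivAt (a := 0)
    (continuous_trapezoid (s := s) (by linarith)).continuousOn
    (fun x hx => hasDerivAt_trapezoid (q := q) hx)
    (fun x hx => mul_nonneg (by linarith) (by linarith [rpow_tangent_le hq hx hs]))
    (mem_Ici.2 hs) (mem_Ici.2 (hs.trans hS)) hS
  simp only [sub_self, zero_mul, mul_zero] at h
  linarith

theorem trapezoid_le_rpow_sub {q s S : ℝ} (hq0 : 0 ≤ q) (hq : q ≤ 1) (hs : 0 ≤ s) (hS : s ≤ S) :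
    (q + 1) / 2 * ((S - s) * (S ^ q + s ^ q)) ≤ S ^ (q + 1) - s ^ (q + 1) := by
  have h := monotoneOn_Ici_of_hasDerivAt (a := 0)
    (continuous_trapezoid (s := s) hq0).neg.continuousOn
    (fun x hx => (hasDerivAt_trapezoid (q := q) hx).neg)
    (fun x hx => neg_nonneg.2 (mul_nonpos_of_nonneg_of_nonpos (by linarith)
      (by linarith [le_rpow_tangent hq0 hq hx hs])))
    (mem_Ici.2 hs) (mem_Ici.2 (hs.trans hS)) hS
  simp only [sub_self, zero_mul, mul_zero, Pi.neg_apply] at h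
  linarith

theorem rpow_sub_le_taylor {q s S : ℝ} (hq : 1 ≤ q) (hs : 0 < s) (hS : 0 ≤ S) (hSs : S ≤ s) :
    S ^ (q + 1) - s ^ (q + 1) - (q + 1) * s ^ q * (S - s) ≤
      (q + 1) / 2 * (q * s ^ (q - 1)) * (S - s) ^ 2 := by
  have h := monotoneOn_Ici_of_hasDerivAt (a := 0)
    (continuous_taylor (s := s) (by linarith)).continuousOn
    (fun x hx => hasDerivAt_taylor (q := q) hx)
    (fun x hx => mul_nonneg (by linarith) (by linarith [rpow_tangent_le hq hs hx.le]))
    (mem_Ici.2 hS) (mem_Ici.2 hs.le) hSs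
  simp only [sub_self, mul_zero, ne_eq, OfNat.ofNat_ne_zero, not_false_eq_true,
    zero_pow, sub_zero] at h
  linarith

theorem taylor_le_rpow_sub {q s S : ℝ} (hq0 : 0 ≤ q) (hq : q ≤ 1) (hs : 0 < s) (hS : 0 ≤ S)
    (hSs : S ≤ s) :
    (q + 1) / 2 * (q * s ^ (q - 1)) * (S - s) ^ 2 ≤
      S ^ (q + 1) - s ^ (q + 1) - (q + 1) * s ^ q * (S - s) := by
  have h := monotoneOn_Ici_of_hasDerivAt (a := 0)
    (continuous_taylor (s := s) hq0).neg.continuousOn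
    (fun x hx => (hasDerivAt_taylor (q := q) hx).neg)
    (fun x hx => neg_nonneg.2 (mul_nonpos_of_nonneg_of_nonpos (by linarith)
      (by linarith [le_rpow_tangent hq0 hq hs hx.le])))
    (mem_Ici.2 hS) (mem_Ici.2 hs.le) hSs
  simp only [sub_self, mul_zero, ne_eq, OfNat.ofNat_ne_zero, not_false_eq_true,
    zero_pow, sub_zero, Pi.neg_apply] at h
  linarith

/-- The convexity estimates at `(x, y)` in the closed first quadrant, for exponents at least two:
`A`, `B` stand for `s ^ (p - 1)` and its derivative at `s = x + y`, `D` and `Δ` for the increments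
of `s` and `s ^ (p - 1)`, and `T` for the second-order remainder of `s ^ p / p`. -/
theorem tangent_bound_large {x y h k A B Δ T D : ℝ} (hx : 0 ≤ x) (hy : 0 ≤ y) (hkh : |k| ≤ |h|)
    (hB : 0 ≤ B) (hAB : A ≤ B * (x + y)) (hΔ : B * D ≤ Δ)
    (hD : D = |x + h| + |y + k| - (x + y))
    (hpos : 0 ≤ D → T ≤ D * Δ / 2) (hneg : D ≤ 0 → T ≤ B * D ^ 2 / 2) :
    T ≤ |x + h| * Δ - x * B * (h + k) + A * (k - |y + k| + y) := by
  have hsq : k ^ 2 ≤ h ^ 2 := sq_le_sq.2 hkh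
  have key : |x + h| * (B * D) - x * B * (h + k) + B * (x + y) * (k - |y + k| + y)
      = B * (h ^ 2 - k ^ 2) / 2 + B * D ^ 2 / 2 := by
    rcases abs_cases (x + h) with ⟨e1, _⟩ | ⟨e1, _⟩ <;>
    rcases abs_cases (y + k) with ⟨e2, _⟩ | ⟨e2, _⟩ <;>
    rw [hD, e1, e2] <;> ring
  have hA : B * (x + y) * (k - |y + k| + y) ≤ A * (k - |y + k| + y) :=
    mul_le_mul_of_nonpos_right hAB (by linarith [le_abs_self (y + k)])
  have hBB : 0 ≤ B * (h ^ 2 - k ^ 2) := mul_nonneg hB (by linarith)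
  rcases le_total D 0 with h0 | h0
  · have := mul_le_mul_of_nonneg_left hΔ (abs_nonneg (x + h))
    linarith [hneg h0]
  · have h2 : 0 ≤ |x + h| - D / 2 := by
      rcases abs_cases (x + h) with ⟨e1, _⟩ | ⟨e1, _⟩ <;>
      rcases abs_cases (y + k) with ⟨e2, _⟩ | ⟨e2, _⟩ <;>
      rcases abs_cases h with ⟨e3, _⟩ | ⟨e3, _⟩ <;>
      rcases abs_cases k with ⟨e4, _⟩ | ⟨e4, _⟩ <;>
      rw [e1, e2] at hD <;> rw [e3, e4] at hkh <;> rw [e1] <;> linarith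
    have := mul_le_mul_of_nonneg_left hΔ h2
    nlinarith [hpos h0]

/-- The counterpart of `tangent_bound_large` for exponents between one and two. -/
theorem tangent_bound_small {x y h k A B Δ T D : ℝ} (hx : 0 ≤ x) (hy : 0 ≤ y) (hkh : |k| ≤ |h|)
    (hB : 0 ≤ B) (hAB : B * (x + y) ≤ A) (hΔ : Δ ≤ B * D)
    (hD : D = |x + h| + |y + k| - (x + y)) (hΔ0 : 0 ≤ D → 0 ≤ Δ)
    (hpos : 0 ≤ D → D * Δ / 2 ≤ T) (hneg : D ≤ 0 → B * D ^ 2 / 2 ≤ T) :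
    |y + k| * Δ - y * B * (h + k) + A * (h - |x + h| + x) ≤ T := by
  have hsq : k ^ 2 ≤ h ^ 2 := sq_le_sq.2 hkh
  have key : |y + k| * (B * D) - y * B * (h + k) + B * (x + y) * (h - |x + h| + x)
      = B * D ^ 2 / 2 - B * (h ^ 2 - k ^ 2) / 2 := by
    rcases abs_cases (x + h) with ⟨e1, _⟩ | ⟨e1, _⟩ <;>
    rcases abs_cases (y + k) with ⟨e2, _⟩ | ⟨e2, _⟩ <;>
    rw [hD, e1, e2] <;> ring
  have hA : A * (h - |x + h| + x) ≤ B * (x + y) * (h - |x + h| + x) :=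
    mul_le_mul_of_nonpos_right hAB (by linarith [le_abs_self (x + h)])
  have hBB : 0 ≤ B * (h ^ 2 - k ^ 2) := mul_nonneg hB (by linarith)
  rcases le_total D 0 with h0 | h0
  · have := mul_le_mul_of_nonneg_left hΔ (abs_nonneg (y + k))
    linarith [hneg h0]
  · rcases le_total 0 (|y + k| - D / 2) with h2 | h2
    · have := mul_le_mul_of_nonneg_left hΔ h2
      nlinarith [hpos h0]
    · have h3 := mul_nonneg (neg_nonneg.2 h2) (hΔ0 h0)
      have h4 : 0 ≤ y * (h + k) - (x + y) * (h - |x + h| + x) := by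
        rcases abs_cases (x + h) with ⟨e1, _⟩ | ⟨e1, _⟩ <;>
        rcases abs_cases (y + k) with ⟨e2, _⟩ | ⟨e2, _⟩ <;>
        rw [e1, e2] at hD <;> rw [e2] at h2 <;> rw [e1] <;> nlinarith
      have := mul_nonneg hB h4
      nlinarith [hpos h0]

theorem abs_sub_le_add_of_nonneg {a b : ℝ} (ha : 0 ≤ a) (hb : 0 ≤ b) : |a - b| ≤ a + b :=
  abs_le.2 ⟨by linarith, by linarith⟩

theorem mul_rpow_sub_one_le {q a s : ℝ} (ha : 0 ≤ a) (has : a ≤ s) :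
    a * s ^ (q - 1) ≤ s ^ q := by
  rcases (ha.trans has).eq_or_lt with h | h
  · obtain rfl : a = 0 := by linarith
    simpa using Real.rpow_nonneg (ha.trans has) q
  · rw [Real.rpow_sub_one h.ne', mul_div_assoc', div_le_iff₀ h, mul_comm]
    exact mul_le_mul_of_nonneg_left has (Real.rpow_nonneg h.le q)

theorem rpow_tangent_large_of_nonneg {q x y h k : ℝ} (hq : 1 ≤ q) (hx : 0 ≤ x) (hy : 0 ≤ y)
    (hs : 0 < x + y) (hkh : |k| ≤ |h|) :
    (|x + h| + |y + k|) ^ (q + 1) - (q + 1) * |x + h| * (|x + h| + |y + k|) ^ q ≤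
      (x + y) ^ (q + 1) - (q + 1) * x * (x + y) ^ q
        + -(q + 1) * (x * (q * (x + y) ^ (q - 1))) * h
        + (q + 1) * ((x + y) ^ q - x * (q * (x + y) ^ (q - 1))) * k := by
  obtain ⟨S, hS⟩ : ∃ S, S = |x + h| + |y + k| := ⟨_, rfl⟩
  have hS0 : 0 ≤ S := by rw [hS]; positivity
  have hp : 0 < q + 1 := by linarith
  have hBs : (x + y) ^ q ≤ q * (x + y) ^ (q - 1) * (x + y) := by
    rw [Real.rpow_sub_one hs.ne', mul_assoc, div_mul_cancel₀ _ hs.ne']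
    nlinarith [Real.rpow_nonneg hs.le q]
  have key := tangent_bound_large (A := (x + y) ^ q) (B := q * (x + y) ^ (q - 1))
    (Δ := S ^ q - (x + y) ^ q) (D := S - (x + y))
    (T := (S ^ (q + 1) - (x + y) ^ (q + 1) - (q + 1) * (x + y) ^ q * (S - (x + y))) / (q + 1))
    hx hy hkh (by positivity) hBs (rpow_tangent_le hq hs hS0) (by rw [hS])
    (fun h0 => by
      rw [div_le_iff₀ hp]
      linarith [rpow_sub_le_trapezoid hq hs.le (sub_nonneg.1 h0)])
    (fun h0 => by
      rw [div_le_iff₀ hp]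
      linarith [rpow_sub_le_taylor hq hs hS0 (sub_nonpos.1 h0)])
  rw [div_le_iff₀ hp] at key
  rw [← hS]
  have hK : |y + k| = S - |x + h| := by linarith
  rw [hK] at key
  linarith

theorem rpow_tangent_small_of_nonneg {q x y h k : ℝ} (hq0 : 0 < q) (hq : q ≤ 1) (hx : 0 ≤ x)
    (hy : 0 ≤ y) (hs : 0 < x + y) (hkh : |k| ≤ |h|) :
    (q + 1) * |y + k| * (|x + h| + |y + k|) ^ q - (|x + h| + |y + k|) ^ (q + 1) ≤
      (q + 1) * y * (x + y) ^ q - (x + y) ^ (q + 1)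
        + (q + 1) * (y * (q * (x + y) ^ (q - 1)) - (x + y) ^ q) * h
        + (q + 1) * (y * (q * (x + y) ^ (q - 1))) * k := by
  obtain ⟨S, hS⟩ : ∃ S, S = |x + h| + |y + k| := ⟨_, rfl⟩
  have hS0 : 0 ≤ S := by rw [hS]; positivity
  have hp : 0 < q + 1 := by linarith
  have hBs : q * (x + y) ^ (q - 1) * (x + y) ≤ (x + y) ^ q := by
    rw [Real.rpow_sub_one hs.ne', mul_assoc, div_mul_cancel₀ _ hs.ne']
    nlinarith [Real.rpow_nonneg hs.le q]
  have key := tangent_bound_small (A := (x + y) ^ q) (B := q * (x + y) ^ (q - 1))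
    (Δ := S ^ q - (x + y) ^ q) (D := S - (x + y))
    (T := (S ^ (q + 1) - (x + y) ^ (q + 1) - (q + 1) * (x + y) ^ q * (S - (x + y))) / (q + 1))
    hx hy hkh (by positivity) hBs (le_rpow_tangent hq0.le hq hs hS0) (by rw [hS])
    (fun h0 => sub_nonneg.2 (Real.rpow_le_rpow hs.le (sub_nonneg.1 h0) hq0.le))
    (fun h0 => by
      rw [le_div_iff₀ hp]
      linarith [trapezoid_le_rpow_sub hq0.le hq hs.le (sub_nonneg.1 h0)])
    (fun h0 => by
      rw [le_div_iff₀ hp]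
      linarith [taylor_le_rpow_sub hq0.le hq hs hS0 (sub_nonpos.1 h0)])
  rw [le_div_iff₀ hp] at key
  rw [← hS]
  have hK : |x + h| = S - |y + k| := by linarith
  rw [hK] at key
  linarith

/-- The sign of a real number, with the convention that zero is positive. -/
noncomputable def posSign (x : ℝ) : ℝ := if 0 ≤ x then 1 else -1

theorem measurable_posSign : Measurable posSign :=
  Measurable.ite measurableSet_Ici measurable_const measurable_const

theorem posSign_mul_abs (x : ℝ) : posSign x * |x| = x := by
  unfold posSign
  split_ifs with h
  · rw [abs_of_nonneg h, one_mul]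
  · rw [abs_of_neg (not_le.1 h)]; ring

theorem abs_posSign (x : ℝ) : |posSign x| = 1 := by
  unfold posSign
  split_ifs <;> simp

theorem posSign_mul_self (x : ℝ) : posSign x * posSign x = 1 := by
  rw [← abs_mul_abs_self, abs_posSign, one_mul]

theorem abs_add_posSign_mul (x h : ℝ) : |(|x| + posSign x * h)| = |x + h| := by
  rw [← one_mul |(|x| + posSign x * h)|, ← abs_posSign x, ← abs_mul, mul_add, posSign_mul_abs,
    ← mul_assoc, posSign_mul_self, one_mul]

theorem abs_posSign_mul (x h : ℝ) : |posSign x * h| = |h| := by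
  rw [abs_mul, abs_posSign, one_mul]

/-- `U` is a majorant of `|y| ^ p - c ^ p * |x| ^ p` of order `p`, non-positive for `|y| ≤ |x|`,
which along directions of slope at most one lies below its tangents, with slopes `φ` and `ψ`. -/
structure IsBurkholderMajorant (p c : ℝ) (U φ ψ : ℝ → ℝ → ℝ) : Prop where
  measurable : Measurable (fun z : ℝ × ℝ => U z.1 z.2)
  measurable_fst : Measurable (fun z : ℝ × ℝ => φ z.1 z.2)
  measurable_snd : Measurable (fun z : ℝ × ℝ => ψ z.1 z.2)
  exists_bound : ∃ C, ∀ x y, |U x y| ≤ C * (|x| + |y|) ^ p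
  exists_bound_fst : ∃ C, 0 ≤ C ∧ ∀ x y, |φ x y| ≤ C * (|x| + |y|) ^ (p - 1)
  exists_bound_snd : ∃ C, 0 ≤ C ∧ ∀ x y, |ψ x y| ≤ C * (|x| + |y|) ^ (p - 1)
  nonpos : ∀ x y, |y| ≤ |x| → U x y ≤ 0
  majorizes : ∀ x y, |y| ^ p - c ^ p * |x| ^ p ≤ U x y
  tangent : ∀ x y h k, |k| ≤ |h| → U (x + h) (y + k) ≤ U x y + φ x y * h + ψ x y * k

theorem hasDerivAt_weighted {q u v : ℝ} (hq : 0 < q) (hu : 0 < u) (hv : 0 ≤ v) :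
    HasDerivAt (fun u => (q + 1) * (u - v) * ((u + q * v) / (q + 1)) ^ q - u ^ (q + 1))
      ((q + 1) * u * (((u + q * v) / (q + 1)) ^ (q - 1) - u ^ (q - 1))) u := by
  have hw : 0 < (u + q * v) / (q + 1) := by positivity
  have h1 := (((hasDerivAt_id u).add_const (q * v)).div_const (q + 1)).rpow_const
    (p := q) (Or.inl hw.ne')
  have h2 := ((((hasDerivAt_id u).sub_const v).const_mul (q + 1)).mul h1).sub
    (Real.hasDerivAt_rpow_const (p := q + 1) (Or.inl hu.ne'))
  refine h2.congr_deriv ?_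
  simp only [add_sub_cancel_right, id]
  have e1 : u ^ q = u * u ^ (q - 1) := by
    rw [Real.rpow_sub_one hu.ne']; field_simp
  have e2 : ((u + q * v) / (q + 1)) ^ q
      = (u + q * v) / (q + 1) * ((u + q * v) / (q + 1)) ^ (q - 1) := by
    rw [Real.rpow_sub_one hw.ne', mul_div_cancel₀ _ hw.ne']
  rw [e1, e2]
  generalize ((u + q * v) / (q + 1)) ^ (q - 1) = W
  field_simp
  ring

theorem continuous_weighted {q v : ℝ} (hq : 0 < q) :
    Continuous (fun u : ℝ =>
      (q + 1) * (u - v) * ((u + q * v) / (q + 1)) ^ q - u ^ (q + 1)) := by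
  have h1 := Real.continuous_rpow_const hq.le
  have h2 := Real.continuous_rpow_const (q := q + 1) (by linarith)
  have h3 : Continuous fun u : ℝ => ((u + q * v) / (q + 1)) ^ q := h1.comp (by fun_prop)
  fun_prop

theorem weighted_le_rpow_sub {q u v : ℝ} (hq : 1 ≤ q) (hu : 0 ≤ u) (hv : 0 ≤ v) :
    (q + 1) * (u - v) * ((u + q * v) / (q + 1)) ^ q ≤ u ^ (q + 1) - v ^ (q + 1) := by
  have hq0 : 0 < q := by linarith
  have hc := continuous_weighted (v := v) hq0
  rcases le_total u v with h | h
  · have hm := monotoneOn_of_hasDerivWithinAt_nonneg (convex_Icc 0 v) hc.continuousOn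
      (fun x hx => (hasDerivAt_weighted hq0 (by rw [interior_Icc] at hx; exact hx.1)
        hv).hasDerivWithinAt)
      (fun x hx => by
        rw [interior_Icc] at hx
        have : x ≤ (x + q * v) / (q + 1) := by
          rw [le_div_iff₀ (by linarith)]; nlinarith [hx.2]
        have := Real.rpow_le_rpow hx.1.le this (sub_nonneg.2 hq)
        exact mul_nonneg (mul_nonneg (by linarith) hx.1.le) (by linarith))
      ⟨hu, h⟩ ⟨hv, le_rfl⟩ h
    simp only [sub_self, mul_zero, zero_mul] at hm
    linarith
  · have hm := antitoneOn_of_hasDerivWithinAt_nonpos (convex_Ici v) hc.continuousOn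
      (fun x hx => (hasDerivAt_weighted hq0 (by
        rw [interior_Ici] at hx; exact hv.trans_lt hx) hv).hasDerivWithinAt)
      (fun x hx => by
        rw [interior_Ici] at hx
        have hx : v < x := hx
        have hw : (x + q * v) / (q + 1) ≤ x := by
          rw [div_le_iff₀ (by linarith)]; nlinarith
        have := Real.rpow_le_rpow (div_nonneg (by nlinarith) (by linarith)) hw (sub_nonneg.2 hq)
        exact mul_nonpos_of_nonneg_of_nonpos (mul_nonneg (by linarith) (by linarith))
          (by linarith))
      (mem_Ici.2 le_rfl) (mem_Ici.2 h) h
    simp only [sub_self, mul_zero, zero_mul] at hm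
    linarith

theorem rpow_sub_le_weighted {q u v : ℝ} (hq0 : 0 < q) (hq : q ≤ 1) (hu : 0 ≤ u) (hv : 0 ≤ v) :
    u ^ (q + 1) - v ^ (q + 1) ≤ (q + 1) * (u - v) * ((u + q * v) / (q + 1)) ^ q := by
  have hc := continuous_weighted (v := v) hq0
  rcases le_total u v with h | h
  · have hm := antitoneOn_of_hasDerivWithinAt_nonpos (convex_Icc 0 v) hc.continuousOn
      (fun x hx => (hasDerivAt_weighted hq0 (by rw [interior_Icc] at hx; exact hx.1)
        hv).hasDerivWithinAt)
      (fun x hx => by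
        rw [interior_Icc] at hx
        have : x ≤ (x + q * v) / (q + 1) := by
          rw [le_div_iff₀ (by linarith)]; nlinarith [hx.2]
        have := Real.rpow_le_rpow_of_nonpos hx.1 this (sub_nonpos.2 hq)
        exact mul_nonpos_of_nonneg_of_nonpos (mul_nonneg (by linarith) hx.1.le) (by linarith))
      ⟨hu, h⟩ ⟨hv, le_rfl⟩ h
    simp only [sub_self, mul_zero, zero_mul] at hm
    linarith
  · have hm := monotoneOn_of_hasDerivWithinAt_nonneg (convex_Ici v) hc.continuousOn
      (fun x hx => (hasDerivAt_weighted hq0 (by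
        rw [interior_Ici] at hx; exact hv.trans_lt hx) hv).hasDerivWithinAt)
      (fun x hx => by
        rw [interior_Ici] at hx
        have hx : v < x := hx
        have hw : (x + q * v) / (q + 1) ≤ x := by
          rw [div_le_iff₀ (by linarith)]; nlinarith
        have := Real.rpow_le_rpow_of_nonpos (div_pos (by nlinarith) (by linarith)) hw
          (sub_nonpos.2 hq)
        exact mul_nonneg (mul_nonneg (by linarith) (by linarith)) (by linarith))
      (mem_Ici.2 le_rfl) (mem_Ici.2 h) h
    simp only [sub_self, mul_zero, zero_mul] at hm
    linarith

theorem exists_isBurkholderMajorant_large {q : ℝ} (hq : 1 ≤ q) :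
    ∃ U φ ψ, IsBurkholderMajorant (q + 1) q U φ ψ := by
  have hq0 : 0 < q := by linarith
  obtain ⟨α, hα⟩ : ∃ α : ℝ, α = (q + 1) * (q / (q + 1)) ^ q := ⟨_, rfl⟩
  have hα0 : 0 < α := by rw [hα]; positivity
  have hnonpos : ∀ x y : ℝ, |y| ≤ |x| →
      α * ((|x| + |y|) ^ (q + 1) - (q + 1) * |x| * (|x| + |y|) ^ q) ≤ 0 := by
    intro x y hxy
    refine mul_nonpos_of_nonneg_of_nonpos hα0.le ?_
    rw [Real.rpow_add_one' (by positivity) (by linarith), mul_comm, ← sub_mul]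
    exact mul_nonpos_of_nonpos_of_nonneg (by nlinarith [abs_nonneg x]) (by positivity)
  refine ⟨fun x y => α * ((|x| + |y|) ^ (q + 1) - (q + 1) * |x| * (|x| + |y|) ^ q),
    fun x y => α * (-(q + 1) * (x * (q * (|x| + |y|) ^ (q - 1)))),
    fun x y => α * ((q + 1) * (posSign y *
      ((|x| + |y|) ^ q - |x| * (q * (|x| + |y|) ^ (q - 1))))), ?_, ?_, ?_,
    ⟨α * (1 + (q + 1)), fun x y => ?_⟩, ⟨α * ((q + 1) * q), by positivity, fun x y => ?_⟩,
    ⟨α * ((q + 1) * (1 + q)), by positivity, fun x y => ?_⟩, hnonpos, fun x y => ?_,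
    fun x y h k hkh => ?_⟩
  · fun_prop
  · fun_prop
  · have := measurable_posSign
    fun_prop
  · rw [abs_mul, abs_of_pos hα0, mul_assoc α]
    refine mul_le_mul_of_nonneg_left
      ((abs_sub_le_add_of_nonneg (by positivity) (by positivity)).trans ?_) hα0.le
    rw [add_mul 1, one_mul,
      Real.rpow_add_one' (y := q) (by positivity) (by linarith), mul_assoc, mul_comm |x|]
    gcongr
    linarith [abs_nonneg y]
  · rw [abs_mul, abs_of_pos hα0, mul_assoc α, add_sub_cancel_right, abs_mul, abs_neg,
      abs_of_pos (by linarith : 0 < q + 1), abs_mul, abs_of_nonneg (by positivity : 0 ≤ q * _),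
      mul_left_comm |x|, mul_assoc (q + 1)]
    gcongr
    exact mul_rpow_sub_one_le (abs_nonneg x) (by linarith [abs_nonneg y])
  · rw [abs_mul, abs_of_pos hα0, mul_assoc α, add_sub_cancel_right, abs_mul,
      abs_of_pos (by linarith : 0 < q + 1), abs_posSign_mul, mul_assoc (q + 1)]
    gcongr
    refine (abs_sub_le_add_of_nonneg (by positivity) (by positivity)).trans ?_
    rw [mul_left_comm |x|,
      add_mul, one_mul]
    gcongr
    exact mul_rpow_sub_one_le (abs_nonneg x) (by linarith [abs_nonneg y])
  · have h := weighted_le_rpow_sub (u := q * |x|) (v := |y|) hq (by positivity) (abs_nonneg y)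
    rw [Real.mul_rpow hq0.le (abs_nonneg x),
      show (q * |x| + q * |y|) / (q + 1) = q / (q + 1) * (|x| + |y|) by ring,
      Real.mul_rpow (by positivity) (by positivity)] at h
    rw [Real.rpow_add_one' (x := |x| + |y|) (by positivity) (by linarith), hα]
    linarith
  · rcases (by positivity : 0 ≤ |x| + |y|).eq_or_lt with hs | hs
    · have hxy := (add_eq_zero_iff_of_nonneg (abs_nonneg x) (abs_nonneg y)).1 hs.symm
      obtain rfl := abs_eq_zero.1 hxy.1
      obtain rfl := abs_eq_zero.1 hxy.2
      have := hnonpos h k hkh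
      simpa [Real.zero_rpow hq0.ne', Real.zero_rpow (by linarith : q + 1 ≠ 0)] using this
    · have := rpow_tangent_large_of_nonneg (h := posSign x * h) (k := posSign y * k) hq
        (abs_nonneg x) (abs_nonneg y) hs (by simpa only [abs_posSign_mul] using hkh)
      rw [abs_add_posSign_mul, abs_add_posSign_mul] at this
      have := mul_le_mul_of_nonneg_left this hα0.le
      refine this.trans_eq ?_
      linear_combination
        -(α * (q + 1) * q * (|x| + |y|) ^ (q - 1) * h) * posSign_mul_abs x

theorem exists_isBurkholderMajorant_small {q : ℝ} (hq0 : 0 < q) (hq : q ≤ 1) :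
    ∃ U φ ψ, IsBurkholderMajorant (q + 1) q⁻¹ U φ ψ := by
  obtain ⟨α, hα⟩ : ∃ α : ℝ, α = (q + 1) * (1 / (q + 1)) ^ q / q := ⟨_, rfl⟩
  have hα0 : 0 < α := by rw [hα]; positivity
  have hnonpos : ∀ x y : ℝ, |y| ≤ |x| →
      α * ((q + 1) * |y| * (|x| + |y|) ^ q - (|x| + |y|) ^ (q + 1)) ≤ 0 := by
    intro x y hxy
    refine mul_nonpos_of_nonneg_of_nonpos hα0.le ?_
    rw [Real.rpow_add_one' (by positivity) (by linarith), mul_comm _ (|x| + |y|), ← sub_mul]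
    exact mul_nonpos_of_nonpos_of_nonneg (by nlinarith [abs_nonneg y]) (by positivity)
  refine ⟨fun x y => α * ((q + 1) * |y| * (|x| + |y|) ^ q - (|x| + |y|) ^ (q + 1)),
    fun x y => α * ((q + 1) * (posSign x *
      (|y| * (q * (|x| + |y|) ^ (q - 1)) - (|x| + |y|) ^ q))),
    fun x y => α * ((q + 1) * (y * (q * (|x| + |y|) ^ (q - 1)))), ?_, ?_, ?_,
    ⟨α * (q + 1 + 1), fun x y => ?_⟩, ⟨α * ((q + 1) * (q + 1)), by positivity, fun x y => ?_⟩,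
    ⟨α * ((q + 1) * q), by positivity, fun x y => ?_⟩, hnonpos, fun x y => ?_,
    fun x y h k hkh => ?_⟩
  · fun_prop
  · have := measurable_posSign
    fun_prop
  · fun_prop
  · rw [abs_mul, abs_of_pos hα0, mul_assoc α]
    refine mul_le_mul_of_nonneg_left
      ((abs_sub_le_add_of_nonneg (by positivity) (by positivity)).trans ?_) hα0.le
    rw [add_mul (q + 1), one_mul,
      Real.rpow_add_one' (y := q) (by positivity) (by linarith), mul_assoc, mul_comm |y|]
    gcongr
    linarith [abs_nonneg x]
  · rw [abs_mul, abs_of_pos hα0, mul_assoc α, add_sub_cancel_right, abs_mul,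
      abs_of_pos (by linarith : 0 < q + 1), abs_posSign_mul, mul_assoc (q + 1)]
    gcongr
    refine (abs_sub_le_add_of_nonneg (by positivity) (by positivity)).trans ?_
    rw [mul_left_comm |y|,
      add_mul q, one_mul]
    gcongr
    exact mul_rpow_sub_one_le (abs_nonneg y) (by linarith [abs_nonneg x])
  · rw [abs_mul, abs_of_pos hα0, mul_assoc α, add_sub_cancel_right, abs_mul,
      abs_of_pos (by linarith : 0 < q + 1), abs_mul, abs_of_nonneg (by positivity : 0 ≤ q * _),
      mul_left_comm |y|, mul_assoc (q + 1)]
    gcongr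
    exact mul_rpow_sub_one_le (abs_nonneg y) (by linarith [abs_nonneg x])
  · have h := rpow_sub_le_weighted (u := |y|) (v := q⁻¹ * |x|) hq0 hq (abs_nonneg y)
      (by positivity)
    rw [Real.mul_rpow (by positivity) (abs_nonneg x), mul_inv_cancel_left₀ hq0.ne',
      show (|y| + |x|) / (q + 1) = 1 / (q + 1) * (|x| + |y|) by ring,
      Real.mul_rpow (by positivity) (by positivity)] at h
    rw [Real.rpow_add_one' (x := |x| + |y|) (by positivity) (by linarith), hα]
    refine h.trans_eq ?_
    field_simp
    ring
  · rcases (by positivity : 0 ≤ |x| + |y|).eq_or_lt with hs | hs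
    · have hxy := (add_eq_zero_iff_of_nonneg (abs_nonneg x) (abs_nonneg y)).1 hs.symm
      obtain rfl := abs_eq_zero.1 hxy.1
      obtain rfl := abs_eq_zero.1 hxy.2
      have := hnonpos h k hkh
      simpa [Real.zero_rpow hq0.ne', Real.zero_rpow (by linarith : q + 1 ≠ 0)] using this
    · have := rpow_tangent_small_of_nonneg (h := posSign x * h) (k := posSign y * k) hq0 hq
        (abs_nonneg x) (abs_nonneg y) hs (by simpa only [abs_posSign_mul] using hkh)
      rw [abs_add_posSign_mul, abs_add_posSign_mul] at this
      have := mul_le_mul_of_nonneg_left this hα0.le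
      refine this.trans_eq ?_
      linear_combination
        (α * (q + 1) * q * (|x| + |y|) ^ (q - 1) * k) * posSign_mul_abs y

section Transform

variable {Ω : Type*} {m : MeasurableSpace Ω} {P : Measure Ω} {p : ℝ}

theorem integrable_abs_add_abs_rpow (hp : 0 < p) {X Y : Ω → ℝ}
    (hX : MemLp X (ENNReal.ofReal p) P) (hY : MemLp Y (ENNReal.ofReal p) P) :
    Integrable (fun ω => (|X ω| + |Y ω|) ^ p) P := by
  have h := (hX.abs.add hY.abs).integrable_norm_rpow (by simpa using hp) ENNReal.ofReal_ne_top
  rw [ENNReal.toReal_ofReal hp.le] at h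
  refine h.congr (ae_of_all _ fun ω => ?_)
  have : 0 ≤ |X ω| + |Y ω| := by positivity
  simp [abs_of_nonneg this]

theorem integrable_mul_of_abs_le_rpow (hp : 1 < p) {W X Y Z : Ω → ℝ} {C : ℝ} (hC : 0 ≤ C)
    (hX : MemLp X (ENNReal.ofReal p) P) (hY : MemLp Y (ENNReal.ofReal p) P)
    (hZ : MemLp Z (ENNReal.ofReal p) P) (hW : AEStronglyMeasurable W P)
    (hb : ∀ ω, |W ω| ≤ C * (|X ω| + |Y ω|) ^ (p - 1)) :
    Integrable (W * Z) P := by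
  have h := (integrable_abs_add_abs_rpow (by linarith) (hX.abs.add hY.abs) hZ).const_mul C
  refine h.mono' (hW.mul hZ.1) (ae_of_all _ fun ω => ?_)
  have hXY : 0 ≤ |X ω| + |Y ω| := by positivity
  simp only [Pi.mul_apply, Pi.add_apply, Pi.abs_apply, norm_mul, Real.norm_eq_abs,
    abs_of_nonneg hXY]
  have hs : 0 ≤ |X ω| + |Y ω| + |Z ω| := by positivity
  calc |W ω| * |Z ω|
      ≤ C * (|X ω| + |Y ω|) ^ (p - 1) * (|X ω| + |Y ω| + |Z ω|) :=
        mul_le_mul (hb ω) (by linarith) (abs_nonneg _) (by positivity)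
    _ ≤ C * (|X ω| + |Y ω| + |Z ω|) ^ (p - 1) * (|X ω| + |Y ω| + |Z ω|) := by
        have := Real.rpow_le_rpow hXY (by linarith [abs_nonneg (Z ω)] :
          |X ω| + |Y ω| ≤ |X ω| + |Y ω| + |Z ω|) (by linarith : 0 ≤ p - 1)
        gcongr
    _ = C * (|X ω| + |Y ω| + |Z ω|) ^ p := by
        rw [mul_assoc, ← Real.rpow_add_one' hs (by linarith), sub_add_cancel]

theorem integral_mul_sub_eq_zero [IsProbabilityMeasure P] {ℱ : Filtration ℕ m} {f : ℕ → Ω → ℝ}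
    (hf : Martingale f ℱ P) {i j : ℕ} (hij : i ≤ j) {W : Ω → ℝ} (hW : StronglyMeasurable[ℱ i] W)
    (hint : Integrable (W * (f j - f i)) P) : ∫ ω, (W * (f j - f i)) ω ∂P = 0 := by
  have h1 := condExp_mul_of_stronglyMeasurable_left hW hint
    ((hf.integrable j).sub (hf.integrable i))
  have h2 := condExp_sub (hf.integrable j) (hf.integrable i) (ℱ i)
  have h3 := hf.condExp_ae_eq hij
  have h4 := hf.condExp_ae_eq (le_refl i)
  rw [← integral_condExp (ℱ.le i), integral_eq_zero_of_ae]
  filter_upwards [h1, h2, h3, h4] with ω e1 e2 e3 e4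
  rw [e1, Pi.mul_apply, e2, Pi.sub_apply, e3, e4, sub_self, mul_zero, Pi.zero_apply]

variable {c : ℝ} {U φ ψ : ℝ → ℝ → ℝ}

theorem IsBurkholderMajorant.integrable (hU : IsBurkholderMajorant p c U φ ψ) (hp : 1 < p)
    {X Y : Ω → ℝ} (hX : MemLp X (ENNReal.ofReal p) P) (hY : MemLp Y (ENNReal.ofReal p) P) :
    Integrable (fun ω => U (X ω) (Y ω)) P := by
  obtain ⟨C, hC⟩ := hU.exists_bound
  refine ((integrable_abs_add_abs_rpow (by linarith) hX hY).const_mul C).mono' ?_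
    (ae_of_all _ fun ω => hC _ _)
  exact (hU.measurable.comp_aemeasurable
    (hX.1.aemeasurable.prodMk hY.1.aemeasurable)).aestronglyMeasurable

theorem IsBurkholderMajorant.integral_step_le [IsProbabilityMeasure P]
    (hU : IsBurkholderMajorant p c U φ ψ) (hp : 1 < p) {ℱ : Filtration ℕ m} {f : ℕ → Ω → ℝ}
    (hf : Martingale f ℱ P) (hfL : ∀ n, MemLp (f n) (ENNReal.ofReal p) P) {n : ℕ}
    {w Y : Ω → ℝ} (hw : StronglyMeasurable[ℱ n] w) (hw1 : ∀ ω, |w ω| ≤ 1)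
    (hY : StronglyMeasurable[ℱ n] Y) (hYL : MemLp Y (ENNReal.ofReal p) P)
    (hYL' : MemLp (fun ω => Y ω + w ω * (f (n + 1) ω - f n ω)) (ENNReal.ofReal p) P) :
    ∫ ω, U (f (n + 1) ω) (Y ω + w ω * (f (n + 1) ω - f n ω)) ∂P ≤ ∫ ω, U (f n ω) (Y ω) ∂P := by
  obtain ⟨C, hC0, hC⟩ := hU.exists_bound_fst
  obtain ⟨C', hC0', hC'⟩ := hU.exists_bound_snd
  obtain ⟨W, hWdef⟩ : ∃ W : Ω → ℝ,
      W = fun ω => φ (f n ω) (Y ω) + ψ (f n ω) (Y ω) * w ω := ⟨_, rfl⟩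
  have hpair : Measurable[ℱ n] fun ω => (f n ω, Y ω) :=
    (hf.stronglyMeasurable n).measurable.prodMk hY.measurable
  have hW : StronglyMeasurable[ℱ n] W := by
    rw [hWdef]
    exact ((hU.measurable_fst.comp hpair).add
      ((hU.measurable_snd.comp hpair).mul hw.measurable)).stronglyMeasurable
  have hWb : ∀ ω, |W ω| ≤ (C + C') * (|f n ω| + |Y ω|) ^ (p - 1) := by
    intro ω
    rw [hWdef, add_mul]
    refine (abs_add_le _ _).trans (add_le_add (hC _ _) ?_)
    rw [abs_mul]
    exact (mul_le_of_le_one_right (abs_nonneg _) (hw1 ω)).trans (hC' _ _)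
  have hint : Integrable (W * (f (n + 1) - f n)) P :=
    integrable_mul_of_abs_le_rpow hp (add_nonneg hC0 hC0') (hfL n) hYL
      ((hfL (n + 1)).sub (hfL n)) (hW.mono (ℱ.le n)).aestronglyMeasurable hWb
  have hle := integral_mono (hU.integrable hp (hfL (n + 1)) hYL')
    ((hU.integrable hp (hfL n) hYL).add hint) (fun ω => by
      have h := hU.tangent (f n ω) (Y ω) (f (n + 1) ω - f n ω) (w ω * (f (n + 1) ω - f n ω))
        (by rw [abs_mul]; exact mul_le_of_le_one_left (abs_nonneg _) (hw1 ω))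
      rw [add_sub_cancel] at h
      refine h.trans_eq ?_
      simp only [hWdef, Pi.add_apply, Pi.mul_apply, Pi.sub_apply]
      ring)
  refine hle.trans_eq ?_
  rw [integral_add' (hU.integrable hp (hfL n) hYL) hint,
    integral_mul_sub_eq_zero hf n.le_succ hW hint, add_zero]

theorem eLpNorm_le_of_integral_abs_rpow_le (hp : 0 < p) (hc : 0 ≤ c) {X Y : Ω → ℝ}
    (hX : MemLp X (ENNReal.ofReal p) P) (hY : MemLp Y (ENNReal.ofReal p) P)
    (h : ∫ ω, |Y ω| ^ p ∂P ≤ c ^ p * ∫ ω, |X ω| ^ p ∂P) :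
    eLpNorm Y (ENNReal.ofReal p) P ≤ ENNReal.ofReal c * eLpNorm X (ENNReal.ofReal p) P := by
  have hp0 : ENNReal.ofReal p ≠ 0 := by simpa using hp
  rw [hY.eLpNorm_eq_integral_rpow_norm hp0 ENNReal.ofReal_ne_top,
    hX.eLpNorm_eq_integral_rpow_norm hp0 ENNReal.ofReal_ne_top, ← ENNReal.ofReal_mul hc,
    ENNReal.toReal_ofReal hp.le]
  simp only [Real.norm_eq_abs]
  refine ENNReal.ofReal_le_ofReal ?_
  have hX0 : 0 ≤ ∫ ω, |X ω| ^ p ∂P := integral_nonneg fun ω => by positivity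
  have hY0 : 0 ≤ ∫ ω, |Y ω| ^ p ∂P := integral_nonneg fun ω => by positivity
  refine (Real.rpow_le_rpow hY0 h (inv_nonneg.2 hp.le)).trans_eq ?_
  rw [Real.mul_rpow (by positivity) hX0, Real.rpow_rpow_inv hc hp.ne']

theorem IsBurkholderMajorant.eLpNorm_le (hU : IsBurkholderMajorant p c U φ ψ) (hp : 1 < p)
    (hc : 0 ≤ c) {X Y : Ω → ℝ} (hX : MemLp X (ENNReal.ofReal p) P)
    (hY : MemLp Y (ENNReal.ofReal p) P) (h : ∫ ω, U (X ω) (Y ω) ∂P ≤ 0) :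
    eLpNorm Y (ENNReal.ofReal p) P ≤ ENNReal.ofReal c * eLpNorm X (ENNReal.ofReal p) P := by
  have hp0 : 0 < p := by linarith
  have hi : ∀ {Z : Ω → ℝ}, MemLp Z (ENNReal.ofReal p) P → Integrable (fun ω => |Z ω| ^ p) P := by
    intro Z hZ
    simpa using integrable_abs_add_abs_rpow hp0 hZ (MemLp.zero (ε := ℝ))
  refine eLpNorm_le_of_integral_abs_rpow_le hp0 hc hX hY ?_
  have hle := integral_mono ((hi hY).sub ((hi hX).const_mul (c ^ p))) (hU.integrable hp hX hY)
    (fun ω => hU.majorizes (X ω) (Y ω))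
  simp only [Pi.sub_apply] at hle
  rw [integral_sub (hi hY) ((hi hX).const_mul _), integral_const_mul] at hle
  linarith

end Transform

theorem exists_isBurkholderMajorant {p : ℝ} (hp : 1 < p) :
    ∃ U φ ψ, IsBurkholderMajorant p (max p (p / (p - 1)) - 1) U φ ψ := by
  have hp1 : 0 < p - 1 := by linarith
  rcases le_total 2 p with h | h
  · have := exists_isBurkholderMajorant_large (q := p - 1) (by linarith)
    rwa [max_eq_left (by rw [div_le_iff₀ hp1]; nlinarith), ← sub_add_cancel p 1,
      add_sub_cancel_right]
  · have := exists_isBurkholderMajorant_small (q := p - 1) (by linarith) (by linarith)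
    have e : max p (p / (p - 1)) - 1 = (p - 1)⁻¹ := by
      rw [max_eq_right (by rw [le_div_iff₀ hp1]; nlinarith)]
      field_simp
      ring
    rwa [e, ← sub_add_cancel p 1, add_sub_cancel_right]

/-- Burkholder's sharp martingale transform inequality: if `f` is a discrete-time
martingale with difference sequence `df_0 = f_0`, `df_k = f_k - f_{k-1}`, and
`v` is a predictable sequence with values in `[-1,1]`, then the martingale transform
`g_n = ∑_{k≤n} v_k df_k` satisfies `sup_n ‖g_n‖_p ≤ (p*-1) sup_n ‖f_n‖_p` for
`1 < p < ∞`, where `p* = max{p, p/(p-1)}`. -/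
theorem stmt8 {Ω : Type} {m : MeasurableSpace Ω} (P : Measure Ω) [IsProbabilityMeasure P]
    (ℱ : MeasureTheory.Filtration ℕ m) (f v g : ℕ → Ω → ℝ)
    (hf : Martingale f ℱ P)
    (hv0 : StronglyMeasurable[ℱ 0] (v 0))
    (hvpred : ∀ k, 1 ≤ k → StronglyMeasurable[ℱ (k - 1)] (v k))
    (hvbdd : ∀ k ω, v k ω ∈ Set.Icc (-1 : ℝ) 1)
    (hg : ∀ n ω, g n ω =
      ∑ k ∈ Finset.range (n + 1), v k ω * (f k ω - if k = 0 then 0 else f (k - 1) ω))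
    (p : ℝ) (hp : 1 < p) :
    ⨆ n, eLpNorm (g n) (ENNReal.ofReal p) P ≤
      ENNReal.ofReal (max p (p / (p - 1)) - 1) *
        ⨆ n, eLpNorm (f n) (ENNReal.ofReal p) P := by
  have hp1 : 0 < p - 1 := by linarith
  have hc : 0 < max p (p / (p - 1)) - 1 := by linarith [le_max_left p (p / (p - 1))]
  obtain ⟨U, φ, ψ, hU⟩ := exists_isBurkholderMajorant hp
  by_cases hfL : ∀ n, MemLp (f n) (ENNReal.ofReal p) P
  swap
  · obtain ⟨n, hn⟩ := not_forall.1 hfL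
    have hn : eLpNorm (f n) (ENNReal.ofReal p) P = ⊤ := by
      by_contra h
      exact hn ⟨(hf.integrable n).1, lt_top_iff_ne_top.2 h⟩
    rw [top_unique (hn.ge.trans (le_iSup (fun n => eLpNorm (f n) (ENNReal.ofReal p) P) n)),
      ENNReal.mul_top (ENNReal.ofReal_pos.2 hc).ne']
    exact le_top
  have hv1 : ∀ k ω, |v k ω| ≤ 1 := fun k ω => abs_le.2 (hvbdd k ω)
  have hg0 : g 0 = fun ω => v 0 ω * f 0 ω := by
    funext ω
    simp [hg]
  have hgs : ∀ n, g (n + 1) = fun ω => g n ω + v (n + 1) ω * (f (n + 1) ω - f n ω) := by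
    intro n
    funext ω
    rw [hg, Finset.sum_range_succ, ← hg]
    simp
  have hvm : ∀ n, StronglyMeasurable[ℱ n] (v (n + 1)) := fun n => hvpred (n + 1) (by omega)
  have hgm : ∀ n, StronglyMeasurable[ℱ n] (g n) := by
    intro n
    induction n with
    | zero => rw [hg0]; exact hv0.mul (hf.stronglyMeasurable 0)
    | succ n ih =>
      have hle := ℱ.mono n.le_succ
      rw [hgs]
      exact (ih.mono hle).add (((hvm n).mono hle).mul
        ((hf.stronglyMeasurable (n + 1)).sub ((hf.stronglyMeasurable n).mono hle)))
  have hmul : ∀ (k : ℕ) (Z : Ω → ℝ), StronglyMeasurable (v k) → MemLp Z (ENNReal.ofReal p) P →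
      MemLp (fun ω => v k ω * Z ω) (ENNReal.ofReal p) P := by
    intro k Z hvk hZ
    refine hZ.of_le (hvk.aestronglyMeasurable.mul hZ.1) (ae_of_all _ fun ω => ?_)
    rw [norm_mul]
    exact mul_le_of_le_one_left (norm_nonneg _) (hv1 k ω)
  have hgL : ∀ n, MemLp (g n) (ENNReal.ofReal p) P := by
    intro n
    induction n with
    | zero => rw [hg0]; exact hmul 0 _ (hv0.mono (ℱ.le 0)) (hfL 0)
    | succ n ih =>
      rw [hgs]
      exact ih.add (hmul (n + 1) _ ((hvm n).mono (ℱ.le n)) ((hfL (n + 1)).sub (hfL n)))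
  have hint : ∀ n, ∫ ω, U (f n ω) (g n ω) ∂P ≤ 0 := by
    intro n
    induction n with
    | zero =>
      refine integral_nonpos fun ω => hU.nonpos _ _ ?_
      rw [hg0, abs_mul]
      exact mul_le_of_le_one_left (abs_nonneg _) (hv1 0 ω)
    | succ n ih =>
      refine le_trans ?_ ih
      have hL := hgL (n + 1)
      rw [hgs] at hL ⊢
      exact hU.integral_step_le hp hf hfL (hvm n) (hv1 (n + 1)) (hgm n) (hgL n) hL
  refine iSup_le fun n => (hU.eLpNorm_le hp hc.le (hfL n) (hgL n) (hint n)).trans ?_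
  gcongr
  exact le_iSup (fun n => eLpNorm (f n) (ENNReal.ofReal p) P) n
end
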